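/- The subspaces M^e_0(Σ_D) ∪ M^e_α(Σ_D) and M^e_0(Σ_D) ∪ M^e_β(Σ_D) of M^e(Σ_D) (with the weak* topology) are each path connected and locally path connected. -/

import Mathlib

open MeasureTheory Topology Filter
open scoped ENNReal NNReal


/-! ### The alphabet of the (M,N) Dyck–Motzkin shift -/

/-- The alphabet `D = D_α ∪ D_0 ∪ D_β` of the `(M,N)` Dyck–Motzkin shift:
`la k` is the left bracket `α_k`, `u k` is the unit `1_k`, `ra k` is the right bracket `β_k`. -/
inductive DMSym (M N : ℕ) : Type where
  | la : Fin M → DMSym M N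
  | u  : Fin N → DMSym M N
  | ra : Fin M → DMSym M N
deriving DecidableEq

namespace DMSym

def equivSum (M N : ℕ) : DMSym M N ≃ (Fin M ⊕ Fin N ⊕ Fin M) where
  toFun s := match s with
    | .la k => Sum.inl k
    | .u k => Sum.inr (Sum.inl k)
    | .ra k => Sum.inr (Sum.inr k)
  invFun s := match s with
    | Sum.inl k => .la k
    | Sum.inr (Sum.inl k) => .u k
    | Sum.inr (Sum.inr k) => .ra k
  left_inv s := by cases s <;> rfl
  right_inv s := by rcases s with k | k | k <;> rfl

instance (M N : ℕ) : Fintype (DMSym M N) := Fintype.ofEquiv _ (equivSum M N).symm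
instance (M N : ℕ) : TopologicalSpace (DMSym M N) := ⊥
instance (M N : ℕ) : DiscreteTopology (DMSym M N) := ⟨rfl⟩
instance (M N : ℕ) : MeasurableSpace (DMSym M N) := ⊤
instance (M N : ℕ) : BorelSpace (DMSym M N) := ⟨borel_eq_top_of_discrete.symm⟩

end DMSym

/-- Nonzero elements of the Dyck–Motzkin monoid with zero are represented in normal form:
`some (bs, as)` is the reduced word `β_{bs(0)} ⋯ β_{bs(r)} α_{as(0)} ⋯ α_{as(s)}`
(in particular `some ([], [])` is the unit element `1`); `none` is the zero element `0`. -/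
abbrev DyckElem (M : ℕ) := Option (List (Fin M) × List (Fin M))

/-- Multiplication, in the Dyck–Motzkin monoid with zero, of an element in normal form on
the right by a generator: units are absorbed, a left bracket is appended, and a right bracket
either closes the last left bracket (if the indices match), is appended (if there is no left
bracket to close), or produces the zero element (if the indices do not match). -/
def dyckStep {M N : ℕ} : DyckElem M → DMSym M N → DyckElem M
  | none, _ => none
  | some (bs, as), .la k => some (bs, as ++ [k])
  | some (bs, as), .u _ => some (bs, as)
  | some (bs, as), .ra k =>
      match as.getLast? with
      | none => some (bs ++ [k], [])
      | some j => if j = k then some (bs, as.dropLast) else none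

/-- `red w` is the image of the word `w` in the Dyck–Motzkin monoid with zero. -/
def red {M N : ℕ} (w : List (DMSym M N)) : DyckElem M :=
  w.foldl dyckStep (some ([], []))

/-- The word `x_j x_{j+1} ⋯ x_k` read off a bi-infinite sequence `x`. -/
def wordAt {M N : ℕ} (x : ℤ → DMSym M N) (j k : ℤ) : List (DMSym M N) :=
  (List.range (k + 1 - j).toNat).map fun n => x (j + n)

/-- The `(M,N)` Dyck–Motzkin shift `Σ_D`. -/
def SigmaD (M N : ℕ) : Set (ℤ → DMSym M N) :=
  {x | ∀ j k : ℤ, j < k → red (wordAt x j k) ≠ none}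

/-- The left shift `σ`. -/
def shift {A : Type*} : (ℤ → A) → (ℤ → A) := fun x i => x (i + 1)

/-- The inverse `σ⁻¹` of the left shift. -/
def shiftInv {A : Type*} : (ℤ → A) → (ℤ → A) := fun x i => x (i - 1)

lemma wordAt_shift {M N : ℕ} (x : ℤ → DMSym M N) (j k : ℤ) :
    wordAt (shift x) j k = wordAt x (j + 1) (k + 1) := by
  simp only [wordAt, shift]
  rw [show (k + 1 + 1 - (j + 1) : ℤ) = k + 1 - j by ring]
  exact List.map_congr_left fun n _ => by rw [show (j + n + 1 : ℤ) = j + 1 + n by ring]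

lemma shift_mem_SigmaD {M N : ℕ} {x : ℤ → DMSym M N} (hx : x ∈ SigmaD M N) :
    shift x ∈ SigmaD M N := by
  intro j k hjk
  rw [wordAt_shift]
  exact hx (j + 1) (k + 1) (by omega)

/-- The left shift acting on `Σ_D`. -/
def shiftD (M N : ℕ) : ↥(SigmaD M N) → ↥(SigmaD M N) :=
  fun x => ⟨shift x.val, shift_mem_SigmaD x.property⟩

section Generic
variable {X : Type*} [MeasurableSpace X]

/-- The set of `T`-invariant Borel probability measures. -/
def InvMeas (T : X → X) : Set (ProbabilityMeasure X) :=
  {μ | MeasurePreserving T μ.toMeasure μ.toMeasure}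

/-- The set of `T`-invariant ergodic Borel probability measures. -/
def ErgMeas (T : X → X) : Set (ProbabilityMeasure X) :=
  {μ | Ergodic T μ.toMeasure}

/-- A `CO`-measure: an invariant ergodic probability measure supported on the orbit of a
single periodic point. -/
def IsCOMeas (T : X → X) (μ : ProbabilityMeasure X) : Prop :=
  Ergodic T μ.toMeasure ∧
    ∃ (x : X) (n : ℕ), 0 < n ∧ T^[n] x = x ∧
      μ.toMeasure {y | ∃ k : ℕ, y = T^[k] x} = 1

/-- Convexity for a set of probability measures: it is stable under taking the convex
combination `t•μ + (1-t)•ν` of any two of its members. -/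
def ConvexMeasSet (U : Set (ProbabilityMeasure X)) : Prop :=
  ∀ μ ∈ U, ∀ ν ∈ U, ∀ t : ℝ≥0∞, t ≤ 1 → ∀ ρ : ProbabilityMeasure X,
    ρ.toMeasure = t • μ.toMeasure + (1 - t) • ν.toMeasure → ρ ∈ U

/-- A measure is fully supported if it gives positive measure to every non-empty open set. -/
def FullSupp [TopologicalSpace X] (μ : ProbabilityMeasure X) : Prop :=
  ∀ U : Set X, IsOpen U → U.Nonempty → 0 < μ.toMeasure U

/-- Measure-theoretic isomorphism of the measure-preserving systems `(X,T,μ)` and `(Y,S,ν)`. -/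
def MeasureIso {Y : Type*} [MeasurableSpace Y] (T : X → X) (S : Y → Y)
    (μ : Measure X) (ν : Measure Y) : Prop :=
  ∃ (φ : X → Y) (ψ : Y → X), Measurable φ ∧ Measurable ψ ∧
    Measure.map φ μ = ν ∧ Measure.map ψ ν = μ ∧
    (∀ᵐ x ∂μ, ψ (φ x) = x) ∧ (∀ᵐ y ∂ν, φ (ψ y) = y) ∧
    (∀ᵐ x ∂μ, φ (T x) = S (φ x))

/-- The system `(X,T,μ)` is Bernoulli: it is measure-theoretically isomorphic to a two-sided
Bernoulli shift, i.e. the left shift on `ℤ → ℕ` equipped with an i.i.d. product measure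
(determined by requiring that the measures of all cylinder sets factorize according to a
fixed distribution `p`). -/
def IsBernoulli (T : X → X) (μ : Measure X) : Prop :=
  ∃ (p : ℕ → ℝ≥0∞) (ν : Measure (ℤ → ℕ)), (∑' n, p n) = 1 ∧
    IsProbabilityMeasure ν ∧
    (∀ (n : ℕ) (w : Fin n → ℕ) (j : ℤ),
      ν {y | ∀ i : Fin n, y (j + (i : ℕ)) = w i} = ∏ i, p (w i)) ∧
    MeasureIso T shift μ ν

end Generic

/-- `M(Σ_D)`: the space of shift-invariant Borel probability measures on `Σ_D`,
endowed with the weak* topology. -/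
def MinvD (M N : ℕ) : Set (ProbabilityMeasure ↥(SigmaD M N)) := InvMeas (shiftD M N)

/-- `M^e(Σ_D)`: the shift-invariant ergodic Borel probability measures on `Σ_D`. -/
def MergD (M N : ℕ) : Set (ProbabilityMeasure ↥(SigmaD M N)) := ErgMeas (shiftD M N)

/-- The integral `∫ f dμ`. -/
noncomputable def intCf {M N : ℕ} (f : C(↥(SigmaD M N), ℝ))
    (μ : ProbabilityMeasure ↥(SigmaD M N)) : ℝ := ∫ x, f x ∂μ.toMeasure

/-- `M_max(f)`: the set of `f`-maximizing measures, i.e. the shift-invariant measures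
attaining `sup { ∫ f dν : ν ∈ M(Σ_D) }`. -/
def Mmax (M N : ℕ) (f : C(↥(SigmaD M N), ℝ)) : Set (ProbabilityMeasure ↥(SigmaD M N)) :=
  {μ ∈ MinvD M N | ∀ ν ∈ MinvD M N, intCf f ν ≤ intCf f μ}

/-- `G_j(x)`: `1` on left brackets, `-1` on right brackets, `0` on units. -/
def Gfun {M N : ℕ} (x : ℤ → DMSym M N) (j : ℤ) : ℤ :=
  match x j with
  | .la _ => 1
  | .u _ => 0
  | .ra _ => -1

/-- `H_i(x) = Σ_{j=0}^{i-1} G_j(x)` for `i ≥ 1`, `H_i(x) = -Σ_{j=i}^{-1} G_j(x)` for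
`i ≤ -1`, and `H_0(x) = 0`. -/
def Hfun {M N : ℕ} (x : ℤ → DMSym M N) (i : ℤ) : ℤ :=
  if 0 ≤ i then ∑ j ∈ Finset.range i.toNat, Gfun x (j : ℤ)
  else -∑ j ∈ Finset.range (-i).toNat, Gfun x (i + (j : ℤ))

/-- The set `A_0`. -/
def A0set (M N : ℕ) : Set (ℤ → DMSym M N) :=
  SigmaD M N ∩ {x | ∀ i : ℤ,
    (∃ j : ℕ, 1 ≤ j ∧ Hfun x (i + (j : ℤ)) = Hfun x i) ∧
    (∃ j : ℕ, 1 ≤ j ∧ Hfun x (i - (j : ℤ)) = Hfun x i)}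

/-- The set `A_α`. -/
def AalphaSet (M N : ℕ) : Set (ℤ → DMSym M N) :=
  SigmaD M N ∩ {x | Tendsto (Hfun x) atTop atTop ∧ Tendsto (Hfun x) atBot atBot}

/-- The set `A_β`. -/
def AbetaSet (M N : ℕ) : Set (ℤ → DMSym M N) :=
  SigmaD M N ∩ {x | Tendsto (Hfun x) atTop atBot ∧ Tendsto (Hfun x) atBot atTop}

/-- `M^{CO}(Σ_D)`: the set of `CO`-measures on `Σ_D`. -/
def MCO (M N : ℕ) : Set (ProbabilityMeasure ↥(SigmaD M N)) :=
  {μ | IsCOMeas (shiftD M N) μ}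

/-- `M^e_0(Σ_D) = { μ ∈ M^e(Σ_D) : μ(A_0) = 1 }`. -/
def Me0 (M N : ℕ) : Set (ProbabilityMeasure ↥(SigmaD M N)) :=
  {μ ∈ MergD M N | μ.toMeasure (Subtype.val ⁻¹' A0set M N) = 1}

/-- `M^e_α(Σ_D) = { μ ∈ M^e(Σ_D) : μ(A_α) = 1 }`. -/
def MeAl (M N : ℕ) : Set (ProbabilityMeasure ↥(SigmaD M N)) :=
  {μ ∈ MergD M N | μ.toMeasure (Subtype.val ⁻¹' AalphaSet M N) = 1}

/-- `M^e_β(Σ_D) = { μ ∈ M^e(Σ_D) : μ(A_β) = 1 }`. -/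
def MeBe (M N : ℕ) : Set (ProbabilityMeasure ↥(SigmaD M N)) :=
  {μ ∈ MergD M N | μ.toMeasure (Subtype.val ⁻¹' AbetaSet M N) = 1}

set_option linter.unusedSectionVars false

section ErgodicSums

/-- Running maxima of Birkhoff sums, defined recursively. -/
noncomputable def runMax {X : Type*} (T : X → X) (h : X → ℝ) : ℕ → X → ℝ
  | 0 => fun _ => 0
  | n + 1 => fun x => max 0 (h x + runMax T h n (T x))

variable {X : Type*} [MeasurableSpace X] {m : Measure X} {T : X → X} {h : X → ℝ}

lemma runMax_nonneg (n : ℕ) (x : X) : 0 ≤ runMax T h n x := by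
  cases n
  · exact le_rfl
  · exact le_max_left _ _

lemma runMax_mono (n : ℕ) : ∀ x : X, runMax T h n x ≤ runMax T h (n + 1) x := by
  induction n with
  | zero => intro x; exact le_max_left _ _
  | succ k ih =>
    intro x
    have := ih (T x)
    simp only [runMax] at this ⊢
    gcongr

lemma birkhoffSum_le_runMax (n : ℕ) : ∀ x : X, birkhoffSum T h n x ≤ runMax T h n x := by
  induction n with
  | zero => intro x; simp [runMax]
  | succ k ih =>
    intro x
    rw [birkhoffSum_succ', runMax]
    exact le_max_of_le_right (by have := ih (T x); linarith)

lemma measurable_runMax (hT : Measurable T) (hh : Measurable h) (n : ℕ) :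
    Measurable (runMax T h n) := by
  induction n with
  | zero => exact measurable_const
  | succ k ih => exact measurable_const.max (hh.add (ih.comp hT))

lemma runMax_le {C : ℝ} (hC : ∀ x, |h x| ≤ C) (n : ℕ) : ∀ x, runMax T h n x ≤ n * C := by
  induction n with
  | zero => intro x; simp [runMax]
  | succ k ih =>
    intro x
    have h1 := ih (T x)
    have h2 := abs_le.1 (hC x)
    have h3 : 0 ≤ C := (abs_nonneg _).trans (hC x)
    simp only [runMax]
    push_cast
    refine max_le (by positivity) (by linarith [h2.2])

lemma integrable_of_bdd [IsProbabilityMeasure m] {g : X → ℝ} (hg : Measurable g) {C : ℝ}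
    (hC : ∀ x, |g x| ≤ C) : Integrable g m :=
  Integrable.of_bound hg.aestronglyMeasurable C (Eventually.of_forall hC)

/-- Maximal ergodic lemma. -/
lemma maximal_ergodic [IsProbabilityMeasure m] (hT : MeasurePreserving T m m) (hh : Measurable h)
    {C : ℝ} (hC : ∀ x, |h x| ≤ C) (hx : ∀ᵐ x ∂m, ∃ n, 0 < birkhoffSum T h n x) :
    0 ≤ ∫ x, h x ∂m := by
  have hM := fun n => measurable_runMax (h := h) hT.measurable hh n
  have hMi : ∀ n, Integrable (runMax T h n) m := fun n =>
    integrable_of_bdd (hM n) (C := n * C) fun x => by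
      rw [abs_of_nonneg (runMax_nonneg n x)]; exact runMax_le hC n x
  have key : ∀ n, 0 ≤ ∫ x, ({x | 0 < runMax T h (n + 1) x}).indicator h x ∂m := by
    intro n
    have hset : MeasurableSet {x | 0 < runMax T h (n + 1) x} :=
      measurableSet_lt measurable_const (hM _)
    have hIntg : Integrable (fun x => runMax T h n (T x)) m :=
      (hT.integrable_comp (hMi n).aestronglyMeasurable).2 (hMi n)
    have h1 : ∫ x, (runMax T h (n + 1) x - runMax T h n (T x)) ∂m ≤
        ∫ x, ({x | 0 < runMax T h (n + 1) x}).indicator h x ∂m := by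
      refine integral_mono ((hMi _).sub hIntg)
        ((integrable_of_bdd hh hC).indicator hset) ?_
      intro x
      by_cases hpos : 0 < runMax T h (n + 1) x
      · simp only [Set.indicator, Set.mem_ofPred_eq, hpos, if_true]
        have : runMax T h (n + 1) x = h x + runMax T h n (T x) := by
          simp only [runMax] at hpos ⊢
          rcases max_choice 0 (h x + runMax T h n (T x)) with h0 | h0
          · rw [h0] at hpos; exact absurd hpos (lt_irrefl _)
          · exact h0
        linarith
      · simp only [Set.indicator, Set.mem_ofPred_eq, hpos, if_false]
        have := runMax_nonneg (T := T) (h := h) n (T x)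
        linarith
    have h2 : ∫ x, (runMax T h (n + 1) x - runMax T h n (T x)) ∂m =
        ∫ x, runMax T h (n + 1) x ∂m - ∫ x, runMax T h n x ∂m := by
      rw [integral_sub (hMi _) hIntg]
      congr 1
      have := integral_map (μ := m) hT.measurable.aemeasurable (f := runMax T h n)
        (by rw [hT.map_eq]; exact (hMi n).aestronglyMeasurable)
      rw [hT.map_eq] at this
      exact this.symm
    have h3 : ∫ x, runMax T h n x ∂m ≤ ∫ x, runMax T h (n + 1) x ∂m :=
      integral_mono (hMi _) (hMi _) (runMax_mono n)
    linarith
  have hlim : Tendsto (fun n => ∫ x, ({x | 0 < runMax T h (n + 1) x}).indicator h x ∂m) atTop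
      (𝓝 (∫ x, h x ∂m)) := by
    refine tendsto_integral_of_dominated_convergence (fun _ => C) ?_ (integrable_const _) ?_ ?_
    · intro n
      exact (hh.indicator (measurableSet_lt measurable_const (hM _))).aestronglyMeasurable
    · intro n
      refine Eventually.of_forall fun x => ?_
      refine (norm_indicator_le_norm_self _ _).trans (hC x)
    · filter_upwards [hx] with x ⟨n, hn⟩
      refine tendsto_const_nhds.congr' ?_
      filter_upwards [eventually_ge_atTop n] with k hk
      have hmono : Monotone fun k => runMax T h k x :=
        monotone_nat_of_le_succ fun k => runMax_mono k x
      have : 0 < runMax T h (k + 1) x :=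
        (hn.trans_le (birkhoffSum_le_runMax n x)).trans_le (hmono (by omega))
      simp [Set.indicator, this]
  exact ge_of_tendsto' hlim key

lemma measurable_birkhoffSum' (hT : Measurable T) (hh : Measurable h) (n : ℕ) :
    Measurable (birkhoffSum T h n) := by
  unfold birkhoffSum
  exact Finset.measurable_sum _ fun k _ => hh.comp (hT.iterate k)

/-- Positive drift forces the Birkhoff sums to tend to infinity. -/
lemma birkhoffSum_tendsto_of_pos [IsProbabilityMeasure m] (hT : Ergodic T m) {g : X → ℝ}
    (hg : Measurable g) {C : ℝ} (hC : ∀ x, |g x| ≤ C) (hpos : 0 < ∫ x, g x ∂m) :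
    ∀ᵐ x ∂m, Tendsto (fun n => birkhoffSum T g n x) atTop atTop := by
  set A : Set X := {x | Tendsto (fun n => birkhoffSum T g n x) atTop atTop} with hA
  have hAm : MeasurableSet A := by
    have : A = ⋂ K : ℕ, ⋃ n : ℕ, ⋂ k ≥ n, {x | (K : ℝ) ≤ birkhoffSum T g k x} := by
      ext x
      simp only [hA, Set.mem_ofPred_eq, Set.mem_iInter, Set.mem_iUnion]
      rw [tendsto_atTop]
      constructor
      · intro hx K
        exact eventually_atTop.1 (hx K)
      · intro hx b
        obtain ⟨K, hK⟩ := exists_nat_ge b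
        filter_upwards [eventually_atTop.2 (hx K)] with k hk
        exact hK.trans hk
    rw [this]
    refine MeasurableSet.iInter fun K => MeasurableSet.iUnion fun n => MeasurableSet.iInter fun k =>
      MeasurableSet.iInter fun _ => ?_
    exact measurableSet_le measurable_const (measurable_birkhoffSum' hT.measurable hg k)
  have hinv : T ⁻¹' A = A := by
    ext x
    simp only [hA, Set.mem_preimage, Set.mem_ofPred_eq]
    rw [← tendsto_add_atTop_iff_nat (f := fun n => birkhoffSum T g n x) 1]
    simp only [birkhoffSum_succ']
    constructor
    · intro hx; exact tendsto_atTop_add_const_left _ _ hx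
    · intro hx
      have := tendsto_atTop_add_const_left _ (-g x) hx
      simpa using this
  rcases hT.toPreErgodic.ae_mem_or_ae_notMem hAm hinv with h1 | h1
  · exact h1
  exfalso
  set d := ∫ x, g x ∂m
  have hm : 0 ≤ ∫ x, (d / 2 - g x) ∂m := by
    refine maximal_ergodic (C := d / 2 + C) hT.toMeasurePreserving (measurable_const.sub hg) ?_ ?_
    · intro x
      have := abs_le.1 (hC x)
      rw [abs_le]; constructor <;> linarith
    · filter_upwards [h1] with x hx
      by_contra! hcon
      apply hx
      have hs : ∀ n, birkhoffSum T (fun x => d / 2 - g x) n x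
          = n * (d / 2) - birkhoffSum T g n x := by
        intro n
        simp [birkhoffSum, Finset.sum_sub_distrib]
      have h2 : ∀ n : ℕ, (n : ℝ) * (d / 2) ≤ birkhoffSum T g n x := fun n => by
        have := hcon n; rw [hs] at this; linarith
      exact tendsto_atTop_mono h2
        (tendsto_natCast_atTop_atTop.atTop_mul_const (by linarith))
  rw [integral_sub (integrable_const _) (integrable_of_bdd hg hC)] at hm
  simp at hm
  change d ≤ d / 2 at hm
  linarith

/-- Zero drift forces recurrence of integer valued Birkhoff sums. -/
lemma birkhoffSum_recurrent [IsProbabilityMeasure m] (hT : Ergodic T m) {g : X → ℤ}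
    (hg : Measurable g) {C : ℝ} (hC : ∀ x, |(g x : ℝ)| ≤ C) (hzero : ∫ x, (g x : ℝ) ∂m = 0) :
    ∀ᵐ x ∂m, ∃ n, 1 ≤ n ∧ birkhoffSum T g n x = 0 := by
  set V : Set X := {x | ∀ n, 1 ≤ n → birkhoffSum T g n x ≠ 0} with hV
  have hgr : Measurable fun x => (g x : ℝ) := (measurable_from_top (f := ((↑) : ℤ → ℝ))).comp hg
  have hVm : MeasurableSet V := by
    have : V = ⋂ n : ℕ, ⋂ (_ : 1 ≤ n), {x | birkhoffSum T g n x = 0}ᶜ := by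
      ext x; simp [hV]
    rw [this]
    refine MeasurableSet.iInter fun n => MeasurableSet.iInter fun _ => MeasurableSet.compl ?_
    have : Measurable (birkhoffSum T g n) := by
      unfold birkhoffSum
      exact Finset.measurable_sum _ fun k _ => hg.comp (hT.measurable.iterate k)
    exact this (measurableSet_singleton 0)
  suffices hn : m V = 0 by
    have : ∀ᵐ x ∂m, x ∉ V := measure_eq_zero_iff_ae_notMem.1 hn
    filter_upwards [this] with x hx
    simp only [hV, Set.mem_ofPred_eq, not_forall, not_not] at hx
    obtain ⟨n, h1, h2⟩ := hx
    exact ⟨n, h1, h2⟩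
  by_contra hne
  set v := m.real V with hv
  have hvpos : 0 < v := by
    rw [hv, Measure.real]; exact ENNReal.toReal_pos hne (measure_ne_top _ _)
  have hcast : ∀ n x, ((birkhoffSum T g n x : ℤ) : ℝ) = birkhoffSum T (fun x => (g x : ℝ)) n x := by
    intro n x; simp [birkhoffSum]
  -- drift bounds
  have e1 : ∀ᵐ x ∂m, Tendsto (fun n => birkhoffSum T (fun x => (g x : ℝ) + v / 8) n x)
      atTop atTop := by
    refine birkhoffSum_tendsto_of_pos (C := C + v / 8) hT (hgr.add measurable_const) ?_ ?_
    · intro x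
      have := abs_le.1 (hC x)
      rw [abs_le]; constructor <;> linarith
    · rw [integral_add (integrable_of_bdd hgr hC) (integrable_const _), hzero]
      simp; linarith
  have e2 : ∀ᵐ x ∂m, Tendsto (fun n => birkhoffSum T (fun x => v / 8 - (g x : ℝ)) n x)
      atTop atTop := by
    refine birkhoffSum_tendsto_of_pos (C := C + v / 8) hT (measurable_const.sub hgr) ?_ ?_
    · intro x
      have := abs_le.1 (hC x)
      rw [abs_le]; constructor <;> linarith
    · rw [integral_sub (integrable_const _) (integrable_of_bdd hgr hC), hzero]
      simp; linarith
  have e3 : ∀ᵐ x ∂m, Tendsto (fun n => birkhoffSum T (fun x => V.indicator (fun _ => (1:ℝ)) x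
      - v / 2) n x) atTop atTop := by
    refine birkhoffSum_tendsto_of_pos (C := 1 + v / 2) hT
      ((measurable_const.indicator hVm).sub measurable_const) ?_ ?_
    · intro x
      have h0 : 0 ≤ V.indicator (fun _ => (1:ℝ)) x := Set.indicator_nonneg (by simp) _
      have h1 : V.indicator (fun _ => (1:ℝ)) x ≤ 1 := Set.indicator_le_self' (by simp) _
      rw [abs_le]; constructor <;> linarith
    · rw [integral_sub ((integrable_const _).indicator hVm) (integrable_const _),
        integral_indicator hVm]
      simp
      change v / 2 < v
      linarith
  have e : ∀ᵐ x ∂m, False := by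
    filter_upwards [e1, e2, e3] with x h1 h2 h3
    -- |S_n| ≤ K + n v / 8 for all n
    obtain ⟨n1, hn1⟩ := eventually_atTop.1 ((tendsto_atTop.1 h1 0).and (tendsto_atTop.1 h2 0))
    have s1 : ∀ n, birkhoffSum T (fun x => (g x : ℝ) + v / 8) n x
        = (birkhoffSum T g n x : ℤ) + n * (v / 8) := by
      intro n; simp [birkhoffSum, Finset.sum_add_distrib]
    have s2 : ∀ n, birkhoffSum T (fun x => v / 8 - (g x : ℝ)) n x
        = n * (v / 8) - (birkhoffSum T g n x : ℤ) := by
      intro n; simp [birkhoffSum, Finset.sum_sub_distrib]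
    obtain ⟨K, hK⟩ : ∃ K : ℝ, ∀ n < n1, |((birkhoffSum T g n x : ℤ) : ℝ)| ≤ K := by
      refine ⟨∑ k ∈ Finset.range n1, |((birkhoffSum T g k x : ℤ) : ℝ)|, fun n hn => ?_⟩
      exact Finset.single_le_sum (f := fun k => |((birkhoffSum T g k x : ℤ) : ℝ)|)
        (fun _ _ => abs_nonneg _) (Finset.mem_range.2 hn)
    have hbd : ∀ n : ℕ, |((birkhoffSum T g n x : ℤ) : ℝ)| ≤ |K| + n * (v / 8) := by
      intro n
      have hp : 0 ≤ (n : ℝ) * (v / 8) := by positivity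
      by_cases hn : n < n1
      · exact (hK n hn).trans ((le_abs_self K).trans (by linarith))
      · obtain ⟨a, b⟩ := hn1 n (by omega)
        rw [s1] at a; rw [s2] at b
        have := abs_nonneg K
        rw [abs_le]; constructor <;> linarith
    -- counting
    have hcount : ∀ n : ℕ, birkhoffSum T (fun x => V.indicator (fun _ => (1:ℝ)) x) n x ≤
        2 * (|K| + n * (v / 8)) + 1 := by
      intro n
      classical
      set F := (Finset.range n).filter (fun k => T^[k] x ∈ V)
      have c1 : birkhoffSum T (fun x => V.indicator (fun _ => (1:ℝ)) x) n x = F.card := by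
        simp [birkhoffSum, F, Set.indicator_apply, Finset.sum_ite]
      set L : ℤ := ⌊|K| + n * (v / 8)⌋
      have hp : 0 ≤ |K| + n * (v / 8) := by positivity
      have hL0 : 0 ≤ L := Int.floor_nonneg.2 hp
      have c2 : F.card ≤ (Finset.Icc (-L) L).card := by
        refine Finset.card_le_card_of_injOn (fun k => birkhoffSum T g k x) ?_ ?_
        · intro k hk
          simp only [F, Finset.coe_filter, Finset.mem_range, Set.mem_ofPred_eq] at hk
          simp only [Finset.coe_Icc, Set.mem_Icc]
          have hb : |((birkhoffSum T g k x : ℤ) : ℝ)| ≤ |K| + n * (v / 8) := by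
            refine (hbd k).trans ?_
            have : (k : ℝ) ≤ n := by exact_mod_cast hk.1.le
            gcongr
          have : |birkhoffSum T g k x| ≤ L := by
            rw [Int.le_floor]; push_cast; exact hb
          exact abs_le.1 this
        · have aux : ∀ a b : ℕ, T^[a] x ∈ V → a < b →
              birkhoffSum T g a x ≠ birkhoffSum T g b x := by
            intro a b ha hab hEq
            have := birkhoffSum_add T g a (b - a) x
            rw [show a + (b - a) = b by omega] at this
            exact ha (b - a) (by omega) (by omega)
          intro a ha b hb hab
          simp only [F, Finset.coe_filter, Finset.mem_range, Set.mem_ofPred_eq] at ha hb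
          rcases lt_trichotomy a b with h | h | h
          · exact absurd hab (aux a b ha.2 h)
          · exact h
          · exact absurd hab.symm (aux b a hb.2 h)
      rw [c1]
      have c3 : ((Finset.Icc (-L) L).card : ℝ) = 2 * L + 1 := by
        rw [Int.card_Icc]
        have : ((L + 1 - -L).toNat : ℤ) = 2 * L + 1 := by omega
        exact_mod_cast this
      have c4 : (L : ℝ) ≤ |K| + n * (v / 8) := Int.floor_le _
      have c5 : (F.card : ℝ) ≤ ((Finset.Icc (-L) L).card : ℝ) := by exact_mod_cast c2
      linarith
    have s3 : ∀ n, birkhoffSum T (fun x => V.indicator (fun _ => (1:ℝ)) x - v / 2) n x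
        = birkhoffSum T (fun x => V.indicator (fun _ => (1:ℝ)) x) n x - n * (v / 2) := by
      intro n; simp [birkhoffSum, Finset.sum_sub_distrib]
    obtain ⟨n, hn⟩ := (tendsto_atTop.1 h3 (2 * |K| + 2)).exists
    rw [s3] at hn
    have := hcount n
    have hp : 0 ≤ (n : ℝ) * v := by positivity
    nlinarith
  have : m = 0 := by
    have := ae_iff.1 e
    simpa using this
  exact IsProbabilityMeasure.ne_zero m this

end ErgodicSums

section Skew

variable {E Y : Type*} [MeasurableSpace E] [MeasurableSpace Y]

/-- The skew product over the shift. -/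
def skewT (Φ : E → Y → Y) : (ℤ → E) × Y → (ℤ → E) × Y := fun z => (shift z.1, Φ (z.1 0) z.2)

/-- The inverse of the skew product over the shift. -/
def skewTinv (Ψ : E → Y → Y) : (ℤ → E) × Y → (ℤ → E) × Y :=
  fun z => (shiftInv z.1, Ψ (z.1 (-1)) z.2)

lemma skew_left_inv {Φ Ψ : E → Y → Y} (h : ∀ e y, Ψ e (Φ e y) = y) (z : (ℤ → E) × Y) :
    skewTinv Ψ (skewT Φ z) = z := by
  rcases z with ⟨w, y⟩
  simp only [skewT, skewTinv, Prod.mk.injEq]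
  refine ⟨?_, ?_⟩
  · funext i; simp [shift, shiftInv]
  · simp [shift, h]

lemma skew_right_inv {Φ Ψ : E → Y → Y} (h : ∀ e y, Φ e (Ψ e y) = y) (z : (ℤ → E) × Y) :
    skewT Φ (skewTinv Ψ z) = z := by
  rcases z with ⟨w, y⟩
  simp only [skewT, skewTinv, Prod.mk.injEq]
  refine ⟨?_, ?_⟩
  · funext i; simp [shift, shiftInv]
  · simp [shiftInv, h]

/-- The sigma-algebra on the driver generated by the coordinates in `S`. -/
@[reducible] def coordS (E : Type*) [MeasurableSpace E] (S : Set ℤ) : MeasurableSpace (ℤ → E) :=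
  ⨆ i ∈ S, MeasurableSpace.comap (fun w : ℤ → E => w i) inferInstance

/-- The sigma-algebra generated by the driver coordinates in `S` and the fibre coordinate. -/
@[reducible] def coordSY (E Y : Type*) [MeasurableSpace E] [MeasurableSpace Y] (S : Set ℤ) :
    MeasurableSpace ((ℤ → E) × Y) :=
  (coordS E S).comap Prod.fst ⊔ MeasurableSpace.comap Prod.snd inferInstance

lemma coordS_le (S : Set ℤ) : coordS E S ≤ MeasurableSpace.pi :=
  iSup₂_le fun i _ => (measurable_pi_apply i).comap_le

lemma coordSY_le (S : Set ℤ) : coordSY E Y S ≤ Prod.instMeasurableSpace :=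
  sup_le_sup (MeasurableSpace.comap_mono (coordS_le S)) le_rfl

lemma coordS_mono {S S' : Set ℤ} (h : S ⊆ S') : coordS E S ≤ coordS E S' :=
  biSup_mono h

lemma coordSY_mono {S S' : Set ℤ} (h : S ⊆ S') : coordSY E Y S ≤ coordSY E Y S' :=
  sup_le_sup (MeasurableSpace.comap_mono (coordS_mono h)) le_rfl

lemma measurable_coordS {S : Set ℤ} {i : ℤ} (hi : i ∈ S) :
    Measurable[coordS E S] (fun w : ℤ → E => w i) := by
  rw [measurable_iff_comap_le]
  exact le_iSup₂ (f := fun i (_ : i ∈ S) => MeasurableSpace.comap (fun w : ℤ → E => w i)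
    inferInstance) i hi

lemma measurable_coordSY_fst (S : Set ℤ) :
    @Measurable _ _ (coordSY E Y S) (coordS E S) Prod.fst := by
  rw [measurable_iff_comap_le]; exact le_sup_left

lemma measurable_coordSY_snd (S : Set ℤ) :
    @Measurable _ _ (coordSY E Y S) _ (Prod.snd : (ℤ → E) × Y → Y) := by
  rw [measurable_iff_comap_le]; exact le_sup_right

lemma measurable_to_coordS {Z : Type*} {mZ : MeasurableSpace Z} {S : Set ℤ} {f : Z → ℤ → E}
    (h : ∀ i ∈ S, Measurable fun z => f z i) : @Measurable _ _ mZ (coordS E S) f := by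
  rw [measurable_iff_comap_le, coordS, MeasurableSpace.comap_iSup]
  refine iSup_le fun i => ?_
  rw [MeasurableSpace.comap_iSup]
  refine iSup_le fun hi => ?_
  rw [MeasurableSpace.comap_comp]
  exact (h i hi).comap_le

lemma measurable_to_coordSY {Z : Type*} {mZ : MeasurableSpace Z} {S : Set ℤ}
    {f : Z → (ℤ → E) × Y} (h : ∀ i ∈ S, Measurable fun z => (f z).1 i)
    (h2 : Measurable fun z => (f z).2) : @Measurable _ _ mZ (coordSY E Y S) f := by
  rw [measurable_iff_comap_le, coordSY, MeasurableSpace.comap_sup, MeasurableSpace.comap_comp,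
    MeasurableSpace.comap_comp]
  refine sup_le ?_ h2.comap_le
  exact (measurable_to_coordS h).comap_le

lemma measurable_skewT_coord {Φ : E → Y → Y} (hΦ : Measurable (Function.uncurry Φ)) (k : ℕ) :
    @Measurable _ _ (coordSY E Y (Set.Ici (-(k : ℤ)))) (coordSY E Y (Set.Ici (-((k + 1 : ℕ) : ℤ))))
      (skewT Φ) := by
  refine @measurable_to_coordSY E Y _ _ _ (coordSY E Y (Set.Ici (-(k : ℤ)))) _ _ ?_ ?_
  · intro i hi
    simp only [Set.mem_Ici] at hi
    have : (i + 1) ∈ Set.Ici (-(k : ℤ)) := by simp only [Set.mem_Ici]; push_cast at hi; omega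
    exact (measurable_coordS this).comp (measurable_coordSY_fst _)
  · have h0 : (0 : ℤ) ∈ Set.Ici (-(k : ℤ)) := by simp
    exact hΦ.comp (((measurable_coordS h0).comp (measurable_coordSY_fst _)).prodMk
      (measurable_coordSY_snd _))

lemma measurable_skewTinv_coord {Ψ : E → Y → Y} (hΨ : Measurable (Function.uncurry Ψ)) (k : ℕ) :
    @Measurable _ _ (coordSY E Y (Set.Iio (k : ℤ))) (coordSY E Y (Set.Iio ((k + 1 : ℕ) : ℤ)))
      (skewTinv Ψ) := by
  refine @measurable_to_coordSY E Y _ _ _ (coordSY E Y (Set.Iio (k : ℤ))) _ _ ?_ ?_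
  · intro i hi
    simp only [Set.mem_Iio] at hi
    have : (i - 1) ∈ Set.Iio (k : ℤ) := by simp only [Set.mem_Iio]; push_cast at hi; omega
    exact (measurable_coordS this).comp (measurable_coordSY_fst _)
  · have h0 : (-1 : ℤ) ∈ Set.Iio (k : ℤ) := by simp only [Set.mem_Iio]; omega
    exact hΨ.comp (((measurable_coordS h0).comp (measurable_coordSY_fst _)).prodMk
      (measurable_coordSY_snd _))

lemma skewT_iterate_meas {Φ : E → Y → Y} (hΦ : Measurable (Function.uncurry Φ)) (k : ℕ) :
    ∀ C : Set ((ℤ → E) × Y), MeasurableSet[coordSY E Y (Set.Ici (-(k : ℤ)))] C →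
      MeasurableSet[coordSY E Y (Set.Ici 0)] ((skewT Φ)^[k] ⁻¹' C) := by
  induction k with
  | zero => intro C hC; simpa using hC
  | succ k ih =>
    intro C hC
    rw [Function.iterate_succ', Set.preimage_comp]
    exact ih _ (measurable_skewT_coord hΦ k hC)

lemma skewTinv_iterate_meas {Ψ : E → Y → Y} (hΨ : Measurable (Function.uncurry Ψ)) (k : ℕ) :
    ∀ C : Set ((ℤ → E) × Y), MeasurableSet[coordSY E Y (Set.Iio (k : ℤ))] C →
      MeasurableSet[coordSY E Y (Set.Iio 0)] ((skewTinv Ψ)^[k] ⁻¹' C) := by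
  induction k with
  | zero => intro C hC; simpa using hC
  | succ k ih =>
    intro C hC
    rw [Function.iterate_succ', Set.preimage_comp]
    exact ih _ (measurable_skewTinv_coord hΨ k hC)

lemma section_meas {S : Set ℤ} {C : Set ((ℤ → E) × Y)} (hC : MeasurableSet[coordSY E Y S] C)
    (y : Y) : MeasurableSet[coordS E S] ((fun w => (w, y)) ⁻¹' C) := by
  have : @Measurable _ _ (coordS E S) (coordSY E Y S) (fun w : ℤ → E => (w, y)) := by
    refine @measurable_to_coordSY E Y _ _ _ (coordS E S) _ _ ?_ ?_
    · intro i hi; exact measurable_coordS hi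
    · exact measurable_const
  exact this hC

/-- Cylinder sets. -/
def cylAlg (E Y : Type*) [MeasurableSpace E] [MeasurableSpace Y] : Set (Set ((ℤ → E) × Y)) :=
  {C | ∃ n : ℕ, MeasurableSet[coordSY E Y (Set.Ico (-(n : ℤ)) n)] C}

lemma cylAlg_alg : IsSetAlgebra (cylAlg E Y) where
  empty_mem := ⟨0, @MeasurableSet.empty _ (_)⟩
  compl_mem := by rintro s ⟨n, hn⟩; exact ⟨n, @MeasurableSet.compl _ _ (_) hn⟩
  union_mem := by
    rintro s t ⟨n, hn⟩ ⟨m, hm⟩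
    refine ⟨max n m, @MeasurableSet.union _ (_) _ _ ?_ ?_⟩
    · exact coordSY_mono (Set.Ico_subset_Ico (by simp) (by simp)) _ hn
    · exact coordSY_mono (Set.Ico_subset_Ico (by simp) (by simp)) _ hm

lemma cylAlg_gen : (Prod.instMeasurableSpace : MeasurableSpace ((ℤ → E) × Y)) =
    MeasurableSpace.generateFrom (cylAlg E Y) := by
  apply le_antisymm
  · have hid : @Measurable _ _ (MeasurableSpace.generateFrom (cylAlg E Y)) Prod.instMeasurableSpace
        (fun z : (ℤ → E) × Y => (z.1, z.2)) := by
      refine @Measurable.prodMk _ (MeasurableSpace.generateFrom (cylAlg E Y)) _ _ _ _ _ _ ?_ ?_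
      · refine @measurable_pi_lambda _ _ _ (MeasurableSpace.generateFrom (cylAlg E Y)) _ _ ?_
        intro i s hs
        apply MeasurableSpace.measurableSet_generateFrom
        refine ⟨i.natAbs + 1, ?_⟩
        have hi : i ∈ Set.Ico (-((i.natAbs + 1 : ℕ) : ℤ)) ((i.natAbs + 1 : ℕ) : ℤ) := by
          simp only [Set.mem_Ico]; omega
        exact ((measurable_coordS hi).comp (measurable_coordSY_fst _)) hs
      · intro s hs
        apply MeasurableSpace.measurableSet_generateFrom
        exact ⟨0, measurable_coordSY_snd _ hs⟩
    intro s hs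
    exact hid hs
  · apply MeasurableSpace.generateFrom_le
    rintro t ⟨n, hn⟩
    exact coordSY_le _ _ hn

variable (κ : Measure E) [IsProbabilityMeasure κ] (ν : Measure Y) [IsProbabilityMeasure ν]

/-- The Bernoulli measure. -/
noncomputable abbrev bern : Measure (ℤ → E) := Measure.infinitePi fun _ : ℤ => κ

lemma bern_shift : MeasurePreserving (shift : (ℤ → E) → (ℤ → E)) (bern κ) (bern κ) := by
  refine ⟨measurable_pi_lambda _ fun i => measurable_pi_apply _, ?_⟩
  exact Measure.map_infinitePi_infinitePi_of_inj (P := fun _ : ℤ => κ) (f := fun i : ℤ => i + 1)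
    (add_left_injective 1)

lemma bern_shiftInv : MeasurePreserving (shiftInv : (ℤ → E) → (ℤ → E)) (bern κ) (bern κ) := by
  refine ⟨measurable_pi_lambda _ fun i => measurable_pi_apply _, ?_⟩
  exact Measure.map_infinitePi_infinitePi_of_inj (P := fun _ : ℤ => κ) (f := fun i : ℤ => i - 1)
    (sub_left_injective)

lemma bern_indep {C₁ C₂ : Set (ℤ → E)} (h₁ : MeasurableSet[coordS E (Set.Ici 0)] C₁)
    (h₂ : MeasurableSet[coordS E (Set.Iio 0)] C₂) :
    bern κ (C₁ ∩ C₂) = bern κ C₁ * bern κ C₂ := by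
  have hi : ProbabilityTheory.iIndepFun (fun (i : ℤ) (w : ℤ → E) => w i) (bern κ) :=
    ProbabilityTheory.iIndepFun_infinitePi (P := fun _ : ℤ => κ) (X := fun _ e => e)
      (fun _ => measurable_id)
  have := ProbabilityTheory.indep_iSup_of_disjoint (fun i => (measurable_pi_apply i).comap_le)
    hi (S := Set.Ici (0 : ℤ)) (T := Set.Iio 0)
      (Set.disjoint_left.2 fun a (ha : 0 ≤ a) (hb : a < 0) => absurd hb (not_lt.2 ha))
  exact (ProbabilityTheory.Indep_iff _ _ _).1 this _ _ h₁ h₂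

lemma skewT_mp {Φ : E → Y → Y} (hΦ : Measurable (Function.uncurry Φ))
    (hmp : ∀ e, MeasurePreserving (Φ e) ν ν) :
    MeasurePreserving (skewT Φ) ((bern κ).prod ν) ((bern κ).prod ν) :=
  (bern_shift κ).skew_product (g := fun w y => Φ (w 0) y)
    (show Measurable fun z : (ℤ → E) × Y => Function.uncurry Φ (z.1 0, z.2) from
      hΦ.comp (((measurable_pi_apply 0).comp measurable_fst).prodMk measurable_snd))
    (Eventually.of_forall fun w => (hmp _).map_eq)

lemma skewTinv_mp {Ψ : E → Y → Y} (hΨ : Measurable (Function.uncurry Ψ))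
    (hmp : ∀ e, MeasurePreserving (Ψ e) ν ν) :
    MeasurePreserving (skewTinv Ψ) ((bern κ).prod ν) ((bern κ).prod ν) :=
  (bern_shiftInv κ).skew_product (g := fun w y => Ψ (w (-1)) y)
    (show Measurable fun z : (ℤ → E) × Y => Function.uncurry Ψ (z.1 (-1), z.2) from
      hΨ.comp (((measurable_pi_apply (-1)).comp measurable_fst).prodMk measurable_snd))
    (Eventually.of_forall fun w => (hmp _).map_eq)

open symmDiff in
lemma indep_ineq {Z : Type*} [MeasurableSpace Z] (P : Measure Z) [IsProbabilityMeasure P]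
    {A C₁ C₂ : Set Z}
    (h : P (C₁ ∩ C₂ᶜ) = P C₁ * P C₂ᶜ) :
    P A * P Aᶜ ≤ 2 * (P (A ∆ C₁) + P (A ∆ C₂)) := by
  have h1 : P A ≤ P C₁ + P (A ∆ C₁) := by
    refine (measure_mono ?_).trans (measure_union_le _ _)
    intro z hz
    by_cases hc : z ∈ C₁
    · exact Or.inl hc
    · exact Or.inr (Or.inl ⟨hz, hc⟩)
  have h2 : P Aᶜ ≤ P C₂ᶜ + P (A ∆ C₂) := by
    refine (measure_mono ?_).trans (measure_union_le _ _)
    intro z hz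
    by_cases hc : z ∈ C₂
    · exact Or.inr (Or.inr ⟨hc, hz⟩)
    · exact Or.inl hc
  have h3 : P (C₁ ∩ C₂ᶜ) ≤ P (A ∆ C₁) + P (A ∆ C₂) := by
    refine (measure_mono ?_).trans (measure_union_le _ _)
    rintro z ⟨hz, hz'⟩
    by_cases hc : z ∈ A
    · exact Or.inr (Or.inl ⟨hc, hz'⟩)
    · exact Or.inl (Or.inr ⟨hz, hc⟩)
  calc P A * P Aᶜ ≤ (P C₁ + P (A ∆ C₁)) * P Aᶜ := by gcongr
    _ = P C₁ * P Aᶜ + P (A ∆ C₁) * P Aᶜ := by ring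
    _ ≤ P C₁ * (P C₂ᶜ + P (A ∆ C₂)) + P (A ∆ C₁) * 1 := by gcongr; exact prob_le_one
    _ = P (C₁ ∩ C₂ᶜ) + P C₁ * P (A ∆ C₂) + P (A ∆ C₁) := by rw [h]; ring
    _ ≤ (P (A ∆ C₁) + P (A ∆ C₂)) + 1 * P (A ∆ C₂) + P (A ∆ C₁) := by
        gcongr; exact prob_le_one
    _ = _ := by ring

open symmDiff in
/-- Invariant sets of the skew product depend only on the fibre coordinate. -/
theorem skew_invariant {Φ Ψ : E → Y → Y} (hΦ : Measurable (Function.uncurry Φ))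
    (hΨ : Measurable (Function.uncurry Ψ)) (hΦΨ : ∀ e y, Φ e (Ψ e y) = y)
    (hmp : ∀ e, MeasurePreserving (Φ e) ν ν) (hmp' : ∀ e, MeasurePreserving (Ψ e) ν ν)
    {A : Set ((ℤ → E) × Y)} (hA : MeasurableSet A) (hinv : skewT Φ ⁻¹' A = A) :
    ∃ D : Set Y, MeasurableSet D ∧ ∀ᵐ z ∂((bern κ).prod ν), z ∈ A ↔ z.2 ∈ D := by
  set m := (bern κ).prod ν with hm
  have hinv' : skewTinv Ψ ⁻¹' A = A := by
    conv_lhs => rw [← hinv]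
    rw [← Set.preimage_comp]
    convert Set.preimage_id
    funext z; exact skew_right_inv hΦΨ z
  have hinvk : ∀ k : ℕ, (skewT Φ)^[k] ⁻¹' A = A := by
    intro k; induction k with
    | zero => rfl
    | succ k ih => rw [Function.iterate_succ, Set.preimage_comp, ih, hinv]
  have hinvk' : ∀ k : ℕ, (skewTinv Ψ)^[k] ⁻¹' A = A := by
    intro k; induction k with
    | zero => rfl
    | succ k ih => rw [Function.iterate_succ, Set.preimage_comp, ih, hinv']
  have hmeasP : Measurable fun y => bern κ ((fun w => (w, y)) ⁻¹' A) :=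
    measurable_measure_prodMk_right hA
  have hmeasP' : Measurable fun y => bern κ ((fun w => (w, y)) ⁻¹' A)ᶜ :=
    measurable_measure_prodMk_right hA.compl
  have key : ∫⁻ y, bern κ ((fun w => (w, y)) ⁻¹' A) * bern κ ((fun w => (w, y)) ⁻¹' A)ᶜ ∂ν = 0 := by
    refine le_antisymm (ENNReal.le_of_forall_pos_le_add ?_) (zero_le)
    intro ε hε _
    rw [zero_add]
    obtain ⟨C, ⟨n, hn⟩, hC⟩ := (Measure.MeasureDense.of_generateFrom_isSetAlgebra_finite m
      (cylAlg_alg (E := E) (Y := Y)) cylAlg_gen).approx A hA (measure_ne_top _ _) (ε / 4)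
      (by positivity)
    have hCm : MeasurableSet C := coordSY_le _ _ hn
    set C₁ := (skewT Φ)^[n] ⁻¹' C
    set C₂ := (skewTinv Ψ)^[n] ⁻¹' C
    have hC₁ : MeasurableSet[coordSY E Y (Set.Ici 0)] C₁ :=
      skewT_iterate_meas hΦ n C (coordSY_mono (fun i hi => hi.1) _ hn)
    have hC₂ : MeasurableSet[coordSY E Y (Set.Iio 0)] C₂ :=
      skewTinv_iterate_meas hΨ n C (coordSY_mono (fun i hi => hi.2) _ hn)
    have hC₁m : MeasurableSet C₁ := coordSY_le _ _ hC₁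
    have hC₂m : MeasurableSet C₂ := coordSY_le _ _ hC₂
    have e1 : m (A ∆ C₁) = m (A ∆ C) := by
      have := ((skewT_mp κ ν hΦ hmp).iterate n).measure_preimage
        (hA.symmDiff hCm).nullMeasurableSet
      rw [← this, Set.preimage_symmDiff, hinvk]
    have e2 : m (A ∆ C₂) = m (A ∆ C) := by
      have := ((skewTinv_mp κ ν hΨ hmp').iterate n).measure_preimage
        (hA.symmDiff hCm).nullMeasurableSet
      rw [← this, Set.preimage_symmDiff, hinvk']
    calc ∫⁻ y, bern κ ((fun w => (w, y)) ⁻¹' A) * bern κ ((fun w => (w, y)) ⁻¹' A)ᶜ ∂ν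
        ≤ ∫⁻ y, 2 * (bern κ ((fun w => (w, y)) ⁻¹' (A ∆ C₁))
            + bern κ ((fun w => (w, y)) ⁻¹' (A ∆ C₂))) ∂ν := by
          refine lintegral_mono fun y => ?_
          exact indep_ineq (bern κ) (bern_indep κ (section_meas hC₁ y)
            (@MeasurableSet.compl _ _ (_) (section_meas hC₂ y)))
      _ = 2 * (m (A ∆ C₁) + m (A ∆ C₂)) := by
          have hadd : Measurable fun y => bern κ ((fun w => (w, y)) ⁻¹' (A ∆ C₁))
              + bern κ ((fun w => (w, y)) ⁻¹' (A ∆ C₂)) :=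
            (measurable_measure_prodMk_right (hA.symmDiff hC₁m)).add
              (measurable_measure_prodMk_right (hA.symmDiff hC₂m))
          rw [lintegral_const_mul _ hadd,
            lintegral_add_left (measurable_measure_prodMk_right (hA.symmDiff hC₁m)), hm,
            Measure.prod_apply_symm (hA.symmDiff hC₁m), Measure.prod_apply_symm (hA.symmDiff hC₂m)]
      _ ≤ 2 * (ENNReal.ofReal (ε / 4) + ENNReal.ofReal (ε / 4)) := by
          rw [e1, e2]; gcongr
      _ = ε := by
          rw [← ENNReal.ofReal_add (by positivity) (by positivity), ← ENNReal.ofReal_ofNat,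
            ← ENNReal.ofReal_mul (by norm_num)]
          rw [← ENNReal.ofReal_coe_nnreal]; congr 1; ring
  have hmul : Measurable fun y => bern κ ((fun w => (w, y)) ⁻¹' A) *
      bern κ ((fun w => (w, y)) ⁻¹' A)ᶜ := hmeasP.mul hmeasP'
  rw [lintegral_eq_zero_iff hmul] at key
  refine ⟨{y | bern κ ((fun w => (w, y)) ⁻¹' A) = 1}, hmeasP (measurableSet_singleton 1), ?_⟩
  have hT : MeasurableSet {z : (ℤ → E) × Y | z ∈ A ↔ z.2 ∈
      {y | bern κ ((fun w => (w, y)) ⁻¹' A) = 1}} :=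
    hA.iff (measurable_snd (hmeasP (measurableSet_singleton 1)))
  have hswap : ∀ᵐ y ∂ν, ∀ᵐ w ∂(bern κ), (w, y) ∈ A ↔ y ∈
      {y | bern κ ((fun w => (w, y)) ⁻¹' A) = 1} := by
    filter_upwards [key] with y hy
    rcases mul_eq_zero.1 hy with h | h
    · have h' : ∀ᵐ w ∂(bern κ), w ∉ ((fun w => (w, y)) ⁻¹' A) := measure_eq_zero_iff_ae_notMem.1 h
      filter_upwards [h'] with w hw
      simp only [Set.mem_ofPred_eq, h, zero_ne_one, iff_false]
      exact hw
    · have h1 : bern κ ((fun w => (w, y)) ⁻¹' A) = 1 := by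
        rwa [prob_compl_eq_zero_iff (measurable_prodMk_right hA)] at h
      have h' : ∀ᵐ w ∂(bern κ), w ∈ ((fun w => (w, y)) ⁻¹' A) := h
      filter_upwards [h'] with w hw
      simp only [Set.mem_ofPred_eq, h1, iff_true]
      exact hw
  rw [hm, ← Measure.prod_swap, ae_map_iff measurable_swap.aemeasurable hT]
  exact (Measure.ae_prod_iff_ae_ae (measurable_swap hT)).2 hswap

/-- The Bernoulli shift is ergodic. -/
theorem bern_ergodic : Ergodic (shift : (ℤ → E) → (ℤ → E)) (bern κ) := by
  refine ⟨bern_shift κ, ⟨fun {s} hs hinv => ?_⟩⟩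
  obtain ⟨D, -, hD⟩ := skew_invariant κ (Measure.dirac ()) (Φ := fun _ y => y) (Ψ := fun _ y => y)
    measurable_snd measurable_snd (fun _ _ => rfl) (fun _ => MeasurePreserving.id _)
    (fun _ => MeasurePreserving.id _) (A := Prod.fst ⁻¹' s) (measurable_fst hs)
    (by rw [← Set.preimage_comp]; conv_rhs => rw [← hinv]
        rfl)
  have h2 : ∀ᵐ w ∂(bern κ), w ∈ s ↔ () ∈ D := by
    have := Measure.ae_ae_of_ae_prod hD
    filter_upwards [this] with w hw
    rw [ae_dirac_eq] at hw
    exact hw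
  rw [eventuallyConst_set]
  by_cases hd : () ∈ D
  · left; filter_upwards [h2] with w hw; exact hw.2 hd
  · right; filter_upwards [h2] with w hw; exact fun h => hd (hw.1 h)

end Skew

section ZeroOne

/-- Sections of full or zero measure: the set depends only on the second coordinate. -/
lemma zero_one_sections {S Z : Type*} [MeasurableSpace S] [MeasurableSpace Z]
    (P : Measure S) [IsProbabilityMeasure P] (ν : Measure Z) [IsProbabilityMeasure ν]
    {A : Set (S × Z)} (hA : MeasurableSet A)
    (key : ∀ᵐ y ∂ν, (∀ᵐ s ∂P, (s, y) ∉ A) ∨ (∀ᵐ s ∂P, (s, y) ∈ A)) :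
    ∃ D : Set Z, MeasurableSet D ∧ ∀ᵐ z ∂(P.prod ν), z ∈ A ↔ z.2 ∈ D := by
  have hmeasP : Measurable fun y => P ((fun w => (w, y)) ⁻¹' A) :=
    measurable_measure_prodMk_right hA
  refine ⟨{y | P ((fun w => (w, y)) ⁻¹' A) = 1}, hmeasP (measurableSet_singleton 1), ?_⟩
  have hT : MeasurableSet {z : S × Z | z ∈ A ↔ z.2 ∈ {y | P ((fun w => (w, y)) ⁻¹' A) = 1}} :=
    hA.iff (measurable_snd (hmeasP (measurableSet_singleton 1)))
  have hswap : ∀ᵐ y ∂ν, ∀ᵐ w ∂P, (w, y) ∈ A ↔ y ∈ {y | P ((fun w => (w, y)) ⁻¹' A) = 1} := by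
    filter_upwards [key] with y hy
    rcases hy with h | h
    · have h' : P ((fun w => (w, y)) ⁻¹' A) = 0 := measure_eq_zero_iff_ae_notMem.2 h
      filter_upwards [h] with w hw
      simp only [Set.mem_ofPred_eq, h', zero_ne_one, iff_false]
      exact hw
    · have h1 : P ((fun w => (w, y)) ⁻¹' A) = 1 := by
        rw [← prob_compl_eq_zero_iff (measurable_prodMk_right hA)]; exact h
      filter_upwards [h] with w hw
      simp only [Set.mem_ofPred_eq, h1, iff_true]
      exact hw
  rw [← Measure.prod_swap, ae_map_iff measurable_swap.aemeasurable hT]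
  exact (Measure.ae_prod_iff_ae_ae (measurable_swap hT)).2 hswap

lemma swap_ae {S Z : Type*} [MeasurableSpace S] [MeasurableSpace Z]
    (P : Measure S) [IsProbabilityMeasure P] (ν : Measure Z) [IsProbabilityMeasure ν]
    {p : S × Z → Prop} (h : ∀ᵐ z ∂(P.prod ν), p z) : ∀ᵐ y ∂ν, ∀ᵐ s ∂P, p (s, y) := by
  rw [← Measure.prod_swap] at h
  have := ae_of_ae_map measurable_swap.aemeasurable h
  exact Measure.ae_ae_of_ae_prod this

lemma ergodic_const {S : Type*} [MeasurableSpace S] {P : Measure S} [IsProbabilityMeasure P]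
    {ρ : S → S} (hρ : Ergodic ρ P) {A : Set S} (hA : MeasurableSet A)
    (h : ∀ᵐ s ∂P, s ∈ A ↔ ρ s ∈ A) : (∀ᵐ s ∂P, s ∉ A) ∨ (∀ᵐ s ∂P, s ∈ A) := by
  have h1 : ρ ⁻¹' A =ᵐ[P] A := by
    filter_upwards [h] with s hs
    exact propext hs.symm
  rcases hρ.quasiErgodic.ae_empty_or_univ₀ hA.nullMeasurableSet h1 with h2 | h2
  · left
    filter_upwards [h2] with s hs hsA
    have : (∅ : Set S) s := hs ▸ hsA
    exact this
  · right
    filter_upwards [h2] with s hs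
    have : Set.univ s := trivial
    rw [← hs] at this; exact this

/-- Invariance under an ergodic map in the first coordinate. -/
lemma ergodic_first {S Z : Type*} [MeasurableSpace S] [MeasurableSpace Z]
    {P : Measure S} [IsProbabilityMeasure P] {ν : Measure Z} [IsProbabilityMeasure ν]
    {ρ : S → S} (hρ : Ergodic ρ P)
    {A : Set (S × Z)} (hA : MeasurableSet A)
    (h : ∀ᵐ z ∂(P.prod ν), z ∈ A ↔ (ρ z.1, z.2) ∈ A) :
    ∃ D : Set Z, MeasurableSet D ∧ ∀ᵐ z ∂(P.prod ν), z ∈ A ↔ z.2 ∈ D := by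
  refine zero_one_sections P ν hA ?_
  filter_upwards [swap_ae P ν h] with y hy
  exact ergodic_const hρ (measurable_prodMk_right (y := y) hA) hy

end ZeroOne

section Coupling

open unitInterval

lemma measurable_shift {A : Type*} [MeasurableSpace A] : Measurable (shift : (ℤ → A) → (ℤ → A)) :=
  measurable_pi_lambda _ fun _ => measurable_pi_apply _

lemma measurable_shiftInv {A : Type*} [MeasurableSpace A] :
    Measurable (shiftInv : (ℤ → A) → (ℤ → A)) :=
  measurable_pi_lambda _ fun _ => measurable_pi_apply _

@[simp] lemma shift_shiftInv {A : Type*} (x : ℤ → A) : shift (shiftInv x) = x := by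
  funext i; simp [shift, shiftInv]

@[simp] lemma shiftInv_shift {A : Type*} (x : ℤ → A) : shiftInv (shift x) = x := by
  funext i; simp [shift, shiftInv]

lemma shiftInv_mp {A : Type*} [MeasurableSpace A] {μ : Measure (ℤ → A)}
    (h : MeasurePreserving shift μ μ) : MeasurePreserving shiftInv μ μ := by
  refine ⟨measurable_shiftInv, ?_⟩
  conv_lhs => rw [← h.map_eq]
  rw [Measure.map_map measurable_shiftInv measurable_shift]
  convert Measure.map_id
  funext x; simp

variable {B : Type*} [MeasurableSpace B]

/-- The fibre space: reservoir and the two sequences. -/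
abbrev FibY (B : Type*) := (ℤ → I) × ((ℤ → B) × (ℤ → B))

/-- The set of reservoir points for which the second sequence is read. -/
def Kset (t : I) : Set (ℤ → I) := {s | t ≠ 0 ∧ s 0 ≤ t}

lemma measurableSet_Kset (t : I) : MeasurableSet (Kset t) := by
  unfold Kset
  by_cases h : t = 0
  · simp [h]
  · simp only [ne_eq, h, not_false_eq_true, true_and]
    exact measurableSet_le (measurable_pi_apply 0) measurable_const

open Classical in
/-- Advance the sequence which is being read. -/
noncomputable def Theta (t : I) : FibY B → FibY B := fun y =>
  (y.1, if y.1 ∈ Kset t then (y.2.1, shift y.2.2) else (shift y.2.1, y.2.2))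

open Classical in
/-- Inverse of `Theta`. -/
noncomputable def ThetaInv (t : I) : FibY B → FibY B := fun y =>
  (y.1, if y.1 ∈ Kset t then (y.2.1, shiftInv y.2.2) else (shiftInv y.2.1, y.2.2))

open Classical in
/-- Refresh the reservoir. -/
noncomputable def Rfr (p e : I) : FibY B → FibY B := fun y =>
  (if e < p then shift y.1 else y.1, y.2)

open Classical in
/-- Inverse of `Rfr`. -/
noncomputable def RfrInv (p e : I) : FibY B → FibY B := fun y =>
  (if e < p then shiftInv y.1 else y.1, y.2)

/-- The fibre maps. -/
noncomputable def PhiY (p t e : I) : FibY B → FibY B := fun y => Rfr p e (Theta t y)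

/-- The inverse fibre maps. -/
noncomputable def PsiY (p t e : I) : FibY B → FibY B := fun y => ThetaInv t (RfrInv p e y)

lemma Theta_ThetaInv (t : I) (y : FibY B) : Theta t (ThetaInv t y) = y := by
  rcases y with ⟨s, x, y⟩
  simp only [Theta, ThetaInv]
  by_cases h : s ∈ Kset t <;> simp [h]

lemma ThetaInv_Theta (t : I) (y : FibY B) : ThetaInv t (Theta t y) = y := by
  rcases y with ⟨s, x, y⟩
  simp only [Theta, ThetaInv]
  by_cases h : s ∈ Kset t <;> simp [h]

lemma Phi_Psi (p t e : I) (y : FibY B) : PhiY p t e (PsiY p t e y) = y := by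
  rw [PhiY, PsiY, Theta_ThetaInv]
  rcases y with ⟨s, x, y⟩
  simp only [Rfr, RfrInv]
  by_cases h : e < p <;> simp [h]

lemma Psi_Phi (p t e : I) (y : FibY B) : PsiY p t e (PhiY p t e y) = y := by
  rw [PhiY, PsiY]
  have : RfrInv p e (Rfr p e (Theta t y)) = Theta t y := by
    simp only [Rfr, RfrInv]
    by_cases h : e < p <;> simp [h]
  rw [this, ThetaInv_Theta]

lemma measurable_Theta (t : I) : Measurable (Theta (B := B) t) := by
  refine measurable_fst.prodMk (Measurable.ite (measurable_fst (measurableSet_Kset t)) ?_ ?_)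
  · exact (measurable_fst.comp measurable_snd).prodMk
      (measurable_shift.comp (measurable_snd.comp measurable_snd))
  · exact (measurable_shift.comp (measurable_fst.comp measurable_snd)).prodMk
      (measurable_snd.comp measurable_snd)

lemma measurable_ThetaInv (t : I) : Measurable (ThetaInv (B := B) t) := by
  refine measurable_fst.prodMk (Measurable.ite (measurable_fst (measurableSet_Kset t)) ?_ ?_)
  · exact (measurable_fst.comp measurable_snd).prodMk
      (measurable_shiftInv.comp (measurable_snd.comp measurable_snd))
  · exact (measurable_shiftInv.comp (measurable_fst.comp measurable_snd)).prodMk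
      (measurable_snd.comp measurable_snd)

lemma measurable_Rfr (p : I) : Measurable fun z : I × FibY B => Rfr p z.1 z.2 := by
  refine Measurable.prodMk (Measurable.ite (measurableSet_lt measurable_fst measurable_const)
    ?_ ?_) (measurable_snd.comp measurable_snd)
  · exact measurable_shift.comp (measurable_fst.comp measurable_snd)
  · exact (measurable_fst.comp measurable_snd)

lemma measurable_RfrInv (p : I) : Measurable fun z : I × FibY B => RfrInv p z.1 z.2 := by
  refine Measurable.prodMk (Measurable.ite (measurableSet_lt measurable_fst measurable_const)
    ?_ ?_) (measurable_snd.comp measurable_snd)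
  · exact measurable_shiftInv.comp (measurable_fst.comp measurable_snd)
  · exact (measurable_fst.comp measurable_snd)

lemma measurable_Phi (p t : I) : Measurable (Function.uncurry (PhiY (B := B) p t)) :=
  (measurable_Rfr p).comp (measurable_fst.prodMk ((measurable_Theta t).comp measurable_snd))

lemma measurable_Psi (p t : I) : Measurable (Function.uncurry (PsiY (B := B) p t)) :=
  (measurable_ThetaInv t).comp (measurable_RfrInv p)

variable (μ ν : Measure (ℤ → B)) [IsProbabilityMeasure μ] [IsProbabilityMeasure ν]

/-- The uniform measure on the unit interval. -/
noncomputable abbrev kap : Measure I := volume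

/-- The measure on the fibre space. -/
noncomputable abbrev fibM : Measure (FibY B) := (bern kap).prod (μ.prod ν)

variable {μ ν}

lemma Theta_mp (hμ : MeasurePreserving shift μ μ) (hν : MeasurePreserving shift ν ν) (t : I) :
    MeasurePreserving (Theta t) (fibM μ ν) (fibM μ ν) := by
  classical
  refine (MeasurePreserving.id _).skew_product (g := fun s z => (Theta t (s, z)).2)
    (measurable_snd.comp (measurable_Theta t)) (Eventually.of_forall fun s => ?_)
  by_cases h : s ∈ Kset t
  · simp only [Theta, h, if_true]
    exact ((MeasurePreserving.id μ).prod hν).map_eq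
  · simp only [Theta, h, if_false]
    exact (hμ.prod (MeasurePreserving.id ν)).map_eq

lemma ThetaInv_mp (hμ : MeasurePreserving shift μ μ) (hν : MeasurePreserving shift ν ν) (t : I) :
    MeasurePreserving (ThetaInv t) (fibM μ ν) (fibM μ ν) := by
  refine ⟨measurable_ThetaInv t, ?_⟩
  conv_lhs => rw [← (Theta_mp hμ hν t).map_eq]
  rw [Measure.map_map (measurable_ThetaInv t) (measurable_Theta t)]
  convert Measure.map_id
  funext x; exact ThetaInv_Theta t x

lemma Rfr_mp (p e : I) : MeasurePreserving (Rfr p e) (fibM μ ν) (fibM μ ν) := by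
  by_cases h : e < p
  · have : Rfr (B := B) p e = Prod.map shift id := by funext y; simp [Rfr, h, Prod.map]
    rw [this]
    exact (bern_shift kap).prod (MeasurePreserving.id _)
  · have : Rfr (B := B) p e = id := by funext y; simp [Rfr, h]
    rw [this]
    exact MeasurePreserving.id _

lemma RfrInv_mp (p e : I) : MeasurePreserving (RfrInv p e) (fibM μ ν) (fibM μ ν) := by
  by_cases h : e < p
  · have : RfrInv (B := B) p e = Prod.map shiftInv id := by funext y; simp [RfrInv, h, Prod.map]
    rw [this]
    exact (bern_shiftInv kap).prod (MeasurePreserving.id _)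
  · have : RfrInv (B := B) p e = id := by funext y; simp [RfrInv, h]
    rw [this]
    exact MeasurePreserving.id _

lemma Phi_mp (hμ : MeasurePreserving shift μ μ) (hν : MeasurePreserving shift ν ν) (p t e : I) :
    MeasurePreserving (PhiY p t e) (fibM μ ν) (fibM μ ν) :=
  (Rfr_mp p e).comp (Theta_mp hμ hν t)

lemma Psi_mp (hμ : MeasurePreserving shift μ μ) (hν : MeasurePreserving shift ν ν) (p t e : I) :
    MeasurePreserving (PsiY p t e) (fibM μ ν) (fibM μ ν) :=
  (ThetaInv_mp hμ hν t).comp (RfrInv_mp p e)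

lemma exists_of_ae_bern {q : (ℤ → I) → Prop} (h : ∀ᵐ w ∂(bern kap), q w) {S : Set I}
    (hSm : MeasurableSet S) (hS : kap S ≠ 0) : ∃ w : ℤ → I, w 0 ∈ S ∧ q w := by
  by_contra! hcon
  apply hS
  rw [← Measure.infinitePi_map_eval (fun _ : ℤ => kap) 0,
    Measure.map_apply (measurable_pi_apply 0) hSm]
  exact measure_mono_null (fun s hs => hcon s hs) (ae_iff.1 h)

lemma kap_Iio {p : I} : kap (Set.Iio p) = ENNReal.ofReal p := by
  simp [kap]

lemma kap_Iic {p : I} : kap (Set.Iic p) = ENNReal.ofReal p := by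
  simp [kap]

lemma kap_Ici {p : I} : kap (Set.Ici p) = ENNReal.ofReal (1 - p) := by
  simp [kap]

lemma kap_Ioi {p : I} : kap (Set.Ioi p) = ENNReal.ofReal (1 - p) := by
  simp [kap]

/-- Ergodicity of the coupled system. -/
theorem skew_ergodic (hμ : Ergodic shift μ) (hν : Ergodic shift ν) {p t : I} (hp0 : 0 < p)
    (hp1 : p < 1) (ht0 : 0 < t) (ht1 : t < 1) :
    Ergodic (skewT (PhiY p t)) ((bern kap).prod (fibM μ ν)) := by
  have hTmp := skewT_mp kap (fibM μ ν) (measurable_Phi p t)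
    (Phi_mp hμ.toMeasurePreserving hν.toMeasurePreserving p t)
  refine ⟨hTmp, ⟨fun {A} hA hinv => ?_⟩⟩
  obtain ⟨D, hDm, hD⟩ := skew_invariant kap (fibM μ ν) (measurable_Phi p t) (measurable_Psi p t)
    (Phi_Psi p t) (Phi_mp hμ.toMeasurePreserving hν.toMeasurePreserving p t)
    (Psi_mp hμ.toMeasurePreserving hν.toMeasurePreserving p t) hA hinv
  have h1 : ∀ᵐ z ∂((bern kap).prod (fibM μ ν)), z.2 ∈ D ↔ PhiY p t (z.1 0) z.2 ∈ D := by
    have h2 := hTmp.quasiMeasurePreserving.ae hD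
    filter_upwards [hD, h2] with z hz1 hz2
    rw [← hz1]
    have : z ∈ A ↔ skewT (PhiY p t) z ∈ A := by
      conv_lhs => rw [← hinv]
      rfl
    rw [this, hz2]; rfl
  have h4 := Measure.ae_ae_of_ae_prod h1
  obtain ⟨w1, he1, hE1⟩ := exists_of_ae_bern h4 (S := Set.Iio p) measurableSet_Iio (by
    rw [kap_Iio]; simpa using hp0)
  obtain ⟨w2, he2, hE2⟩ := exists_of_ae_bern h4 (S := Set.Ici p) measurableSet_Ici (by
    rw [kap_Ici]; simpa using hp1)
  have hTh := Theta_mp hμ.toMeasurePreserving hν.toMeasurePreserving t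
  have f2 : ∀ᵐ y ∂(fibM μ ν), y ∈ D ↔ Theta t y ∈ D := by
    filter_upwards [hE2] with y hy
    have : Rfr p (w2 0) (Theta t y) = Theta t y := by simp [Rfr, not_lt.2 (Set.mem_Ici.1 he2)]
    rw [hy, PhiY, this]
  have f1 : ∀ᵐ y ∂(fibM μ ν), y ∈ D ↔ (shift y.1, y.2) ∈ D := by
    rw [← hTh.map_eq]
    rw [ae_map_iff hTh.measurable.aemeasurable]
    · filter_upwards [hE1, f2] with y hy1 hy2
      rw [← hy2, hy1, PhiY]
      have : Rfr p (w1 0) (Theta t y) = (shift (Theta t y).1, (Theta t y).2) := by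
        simp [Rfr, Set.mem_Iio.1 he1]
      rw [this]
    · exact hDm.iff ((measurable_shift.comp measurable_fst).prodMk measurable_snd hDm)
  obtain ⟨D1, hD1m, hD1⟩ := ergodic_first (bern_ergodic kap) hDm f1
  have f3 : ∀ᵐ y ∂(fibM μ ν), y.2 ∈ D1 ↔ (Theta t y).2 ∈ D1 := by
    filter_upwards [hD1, hTh.quasiMeasurePreserving.ae hD1, f2] with y a b c
    rw [← a, ← b, c]
  have f4 := Measure.ae_ae_of_ae_prod f3
  obtain ⟨s1, hs1, hS1⟩ := exists_of_ae_bern f4 (S := Set.Iic t) measurableSet_Iic (by rw [kap_Iic]; simpa using ht0)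
  obtain ⟨s2, hs2, hS2⟩ := exists_of_ae_bern f4 (S := Set.Ioi t) measurableSet_Ioi (by rw [kap_Ioi]; simpa using ht1)
  have k1 : s1 ∈ Kset t := ⟨ht0.ne', hs1⟩
  have k2 : s2 ∉ Kset t := fun h => absurd h.2 (not_le.2 hs2)
  simp only [Theta, k1, if_true] at hS1
  simp only [Theta, k2, if_false] at hS2
  obtain ⟨D2, hD2m, hD2⟩ := ergodic_first hμ hD1m hS2
  have f6 : ∀ᵐ y ∂(μ.prod ν), y.2 ∈ D2 ↔ shift y.2 ∈ D2 := by
    have q : MeasurePreserving (fun y : (ℤ → B) × (ℤ → B) => (y.1, shift y.2)) (μ.prod ν)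
        (μ.prod ν) := (MeasurePreserving.id μ).prod hν.toMeasurePreserving
    filter_upwards [hD2, q.quasiMeasurePreserving.ae hD2, hS1] with y a b c
    rw [← a, c, b]
  have f7 : ∀ᵐ y ∂ν, y ∈ D2 ↔ shift y ∈ D2 := by
    filter_upwards [swap_ae μ ν f6] with y hy
    exact hy.exists.choose_spec
  have f8 : ∀ᵐ z ∂((bern kap).prod (fibM μ ν)), z ∈ A ↔ z.2.2.2 ∈ D2 := by
    have g1 := (Measure.quasiMeasurePreserving_snd (μ := bern kap) (ν := fibM μ ν)).ae hD1
    have g2 := ((Measure.quasiMeasurePreserving_snd (μ := bern kap) (ν := μ.prod ν)).comp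
      (Measure.quasiMeasurePreserving_snd (μ := bern kap) (ν := fibM μ ν))).ae hD2
    filter_upwards [hD, g1, g2] with z a b c
    rw [a, b]; exact c
  have qq := ((Measure.quasiMeasurePreserving_snd (μ := μ) (ν := ν)).comp
      ((Measure.quasiMeasurePreserving_snd (μ := bern kap) (ν := μ.prod ν)).comp
      (Measure.quasiMeasurePreserving_snd (μ := bern kap) (ν := fibM μ ν))))
  rw [eventuallyConst_set]
  rcases ergodic_const hν hD2m f7 with h | h
  · right
    filter_upwards [f8, qq.ae h] with z a b
    exact fun hz => b (a.1 hz)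
  · left
    filter_upwards [f8, qq.ae h] with z a b
    exact a.2 b

end Coupling

section Path

open unitInterval

variable {B : Type*} [MeasurableSpace B]

/-- The total space. -/
abbrev TotZ (B : Type*) := (ℤ → I) × FibY B

/-- The coupled transformation as a permutation. -/
noncomputable def Tperm (p t : I) : Equiv.Perm (TotZ B) where
  toFun := skewT (PhiY p t)
  invFun := skewTinv (PsiY p t)
  left_inv := skew_left_inv (Psi_Phi p t)
  right_inv := skew_right_inv (Phi_Psi p t)

open Classical in
/-- The symbol being read. -/
noncomputable def outf (t : I) (z : TotZ B) : B :=
  if z.2.1 ∈ Kset t then z.2.2.2 0 else z.2.2.1 0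

/-- The output sequence. -/
noncomputable def wmap (p t : I) (z : TotZ B) : ℤ → B := fun i => outf t ((Tperm p t ^ i) z)

lemma wmap_T (p t : I) (z : TotZ B) : wmap p t (skewT (PhiY p t) z) = shift (wmap p t z) := by
  funext i
  simp only [wmap, shift]
  rw [zpow_add_one]
  rfl

lemma T_fst (p t : I) (z : TotZ B) : (Tperm p t z).1 = shift z.1 := rfl

lemma Tinv_fst (p t : I) (z : TotZ B) : ((Tperm p t)⁻¹ z).1 = shiftInv z.1 := rfl

lemma T_res (p t : I) (z : TotZ B) :
    (Tperm p t z).2.1 = shift z.2.1 ∨ (Tperm p t z).2.1 = z.2.1 := by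
  change (Rfr p (z.1 0) (Theta t z.2)).1 = _ ∨ (Rfr p (z.1 0) (Theta t z.2)).1 = _
  by_cases h : z.1 0 < p <;> simp [Rfr, h, Theta]

lemma T_res' (p t : I) (z : TotZ B) (h : p ≤ z.1 0) : (Tperm p t z).2.1 = z.2.1 := by
  change (Rfr p (z.1 0) (Theta t z.2)).1 = _
  simp [Rfr, not_lt.2 h, Theta]

lemma Tinv_res (p t : I) (z : TotZ B) :
    ((Tperm p t)⁻¹ z).2.1 = shiftInv z.2.1 ∨ ((Tperm p t)⁻¹ z).2.1 = z.2.1 := by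
  change (RfrInv p (z.1 (-1)) z.2).1 = _ ∨ (RfrInv p (z.1 (-1)) z.2).1 = _
  by_cases h : z.1 (-1) < p <;> simp [RfrInv, h]

lemma Tinv_res' (p t : I) (z : TotZ B) (h : p ≤ z.1 (-1)) :
    ((Tperm p t)⁻¹ z).2.1 = z.2.1 := by
  change (RfrInv p (z.1 (-1)) z.2).1 = _
  simp [RfrInv, not_lt.2 h]

lemma T_read (p t : I) (z : TotZ B) (h : z.2.1 ∈ Kset t) :
    (Tperm p t z).2.2 = (z.2.2.1, shift z.2.2.2) := by
  change (Theta t z.2).2 = _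
  simp [Theta, h]

lemma T_read' (p t : I) (z : TotZ B) (h : z.2.1 ∉ Kset t) :
    (Tperm p t z).2.2 = (shift z.2.2.1, z.2.2.2) := by
  change (Theta t z.2).2 = _
  simp [Theta, h]

lemma Tinv_read (p t : I) (z : TotZ B) (h : ((Tperm p t)⁻¹ z).2.1 ∈ Kset t) :
    ((Tperm p t)⁻¹ z).2.2 = (z.2.2.1, shiftInv z.2.2.2) := by
  have h' : (RfrInv p (z.1 (-1)) z.2).1 ∈ Kset t := h
  change (ThetaInv t (RfrInv p (z.1 (-1)) z.2)).2 = _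
  simp only [ThetaInv, h', if_true]
  rfl

lemma Tinv_read' (p t : I) (z : TotZ B) (h : ((Tperm p t)⁻¹ z).2.1 ∉ Kset t) :
    ((Tperm p t)⁻¹ z).2.2 = (shiftInv z.2.2.1, z.2.2.2) := by
  have h' : (RfrInv p (z.1 (-1)) z.2).1 ∉ Kset t := h
  change (ThetaInv t (RfrInv p (z.1 (-1)) z.2)).2 = _
  simp only [ThetaInv, h', if_false]
  rfl

lemma zpow_succ_apply {Z : Type*} (T : Equiv.Perm Z) (i : ℤ) (z : Z) :
    (T ^ (i + 1)) z = T ((T ^ i) z) := by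
  rw [add_comm, zpow_one_add]; rfl

lemma zpow_pred_apply {Z : Type*} (T : Equiv.Perm Z) (i : ℤ) (z : Z) :
    (T ^ (i - 1)) z = T⁻¹ ((T ^ i) z) := by
  rw [show i - 1 = -1 + i by ring, zpow_add, zpow_neg_one]; rfl

lemma Tpow_fst (p t : I) (z : TotZ B) (i : ℤ) (k : ℤ) :
    ((Tperm p t ^ i) z).1 k = z.1 (k + i) := by
  induction i generalizing k with
  | zero => simp
  | succ i ih =>
    rw [zpow_succ_apply, T_fst]; simp only [shift]; rw [ih]; exact congrArg _ (by ring)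
  | pred i ih =>
    rw [zpow_pred_apply, Tinv_fst]; simp only [shiftInv]; rw [ih]; exact congrArg _ (by ring)

/-- If the driver never asks for a refresh in the window, the reservoir is constant. -/
lemma Tpow_res (p t : I) (z : TotZ B) (n : ℕ) (hz : ∀ i : ℤ, -n ≤ i → i ≤ n → p ≤ z.1 i) (i : ℤ) :
    -n ≤ i → i ≤ n → ((Tperm p t ^ i) z).2.1 = z.2.1 := by
  induction i with
  | zero => intro _ _; simp
  | succ i ih =>
    intro h1 h2
    rw [zpow_succ_apply, T_res', ih (by omega) (by omega)]
    rw [Tpow_fst]; exact hz _ (by omega) (by omega)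
  | pred i ih =>
    intro h1 h2
    rw [zpow_pred_apply, Tinv_res', ih (by omega) (by omega)]
    rw [Tpow_fst]; exact hz _ (by omega) (by omega)

lemma Tpow_read (p t : I) (z : TotZ B) (n : ℕ)
    (hz : ∀ i : ℤ, -n ≤ i → i ≤ n → ((Tperm p t ^ i) z).2.1 ∈ Kset t) (i : ℤ) :
    -n ≤ i → i ≤ n → ((Tperm p t ^ i) z).2.2.2 = fun k => z.2.2.2 (k + i) := by
  induction i with
  | zero => intro _ _; simp
  | succ i ih =>
    intro h1 h2
    have := hz i (by omega) (by omega)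
    rw [zpow_succ_apply, T_read _ _ _ this, ih (by omega) (by omega)]
    funext k; simp only [shift]; exact congrArg _ (by ring)
  | pred i ih =>
    intro h1 h2
    have := hz (-i - 1) (by omega) (by omega)
    rw [zpow_pred_apply] at this ⊢
    rw [Tinv_read _ _ _ this, ih (by omega) (by omega)]
    funext k; simp only [shiftInv]; exact congrArg _ (by ring)

lemma Tpow_read' (p t : I) (z : TotZ B) (n : ℕ)
    (hz : ∀ i : ℤ, -n ≤ i → i ≤ n → ((Tperm p t ^ i) z).2.1 ∉ Kset t) (i : ℤ) :
    -n ≤ i → i ≤ n → ((Tperm p t ^ i) z).2.2.1 = fun k => z.2.2.1 (k + i) := by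
  induction i with
  | zero => intro _ _; simp
  | succ i ih =>
    intro h1 h2
    have := hz i (by omega) (by omega)
    rw [zpow_succ_apply, T_read' _ _ _ this, ih (by omega) (by omega)]
    funext k; simp only [shift]; exact congrArg _ (by ring)
  | pred i ih =>
    intro h1 h2
    have := hz (-i - 1) (by omega) (by omega)
    rw [zpow_pred_apply] at this ⊢
    rw [Tinv_read' _ _ _ this, ih (by omega) (by omega)]
    funext k; simp only [shiftInv]; exact congrArg _ (by ring)

lemma wmap_read (p t : I) (z : TotZ B) (n : ℕ)
    (hz : ∀ i : ℤ, -n ≤ i → i ≤ n → ((Tperm p t ^ i) z).2.1 ∈ Kset t) (i : ℤ)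
    (h1 : -n ≤ i) (h2 : i ≤ n) : wmap p t z i = z.2.2.2 i := by
  rw [wmap, outf, if_pos (hz i h1 h2), Tpow_read p t z n hz i h1 h2]; simp

lemma wmap_read' (p t : I) (z : TotZ B) (n : ℕ)
    (hz : ∀ i : ℤ, -n ≤ i → i ≤ n → ((Tperm p t ^ i) z).2.1 ∉ Kset t) (i : ℤ)
    (h1 : -n ≤ i) (h2 : i ≤ n) : wmap p t z i = z.2.2.1 i := by
  rw [wmap, outf, if_neg (hz i h1 h2), Tpow_read' p t z n hz i h1 h2]; simp

open Classical in
/-- The un-refreshed output. -/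
noncomputable def wzero (t : I) (z : TotZ B) : ℤ → B :=
  if z.2.1 ∈ Kset t then z.2.2.2 else z.2.2.1

lemma wmap_zero (p t : I) (z : TotZ B) : wmap p t z 0 = wzero t z 0 := by
  simp only [wmap, outf, wzero, zpow_zero, Equiv.Perm.coe_one, id]
  by_cases h : z.2.1 ∈ Kset t <;> simp [h]

lemma wmap_eq_wzero (p t : I) (z : TotZ B) (n : ℕ) (hz : ∀ i : ℤ, -n ≤ i → i ≤ n → p ≤ z.1 i)
    (i : ℤ) (h1 : -n ≤ i) (h2 : i ≤ n) : wmap p t z i = wzero t z i := by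
  have hr := Tpow_res p t z n hz
  by_cases h : z.2.1 ∈ Kset t
  · rw [wzero, if_pos h]
    exact wmap_read p t z n (fun i a b => by rw [hr i a b]; exact h) i h1 h2
  · rw [wzero, if_neg h]
    exact wmap_read' p t z n (fun i a b => by rw [hr i a b]; exact h) i h1 h2

lemma wmap_one (p : I) (z : TotZ B) : wmap p 1 z = z.2.2.2 := by
  funext i
  refine wmap_read p 1 z i.natAbs (fun j _ _ => ⟨one_ne_zero, le_one'⟩) i (by omega) (by omega)

lemma wmap_zero' (p : I) (z : TotZ B) : wmap p 0 z = z.2.2.1 := by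
  funext i
  refine wmap_read' p 0 z i.natAbs (fun j _ _ h => h.1 rfl) i (by omega) (by omega)

lemma Kset_eventually (t0 : I) (s : ℤ → I) (hs : s 0 ≠ t0) :
    ∀ᶠ t in 𝓝 t0, (s ∈ Kset t ↔ s ∈ Kset t0) := by
  rcases lt_or_gt_of_ne hs with h | h
  · have h0 : 0 < t0 := (nonneg' (t := s 0)).trans_lt h
    filter_upwards [eventually_gt_nhds h, eventually_gt_nhds h0] with t h1 h2
    simp [Kset, h0.ne', h2.ne', h.le, h1.le]
  · filter_upwards [eventually_lt_nhds h] with t h1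
    simp [Kset, not_le.2 h1, not_le.2 h]

lemma T_eventually (p t0 : I) (z : TotZ B) (hz : ∀ k, z.2.1 k ≠ t0) :
    ∀ᶠ t in 𝓝 t0, Tperm p t z = Tperm p t0 z := by
  filter_upwards [Kset_eventually t0 z.2.1 (hz 0)] with t ht
  change (shift z.1, Rfr p (z.1 0) (Theta t z.2)) = (shift z.1, Rfr p (z.1 0) (Theta t0 z.2))
  by_cases h : z.2.1 ∈ Kset t0
  · simp [Theta, h, ht.2 h]
  · simp [Theta, h, mt ht.1 h]

lemma Tinv_eventually (p t0 : I) (z : TotZ B) (hz : ∀ k, z.2.1 k ≠ t0) :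
    ∀ᶠ t in 𝓝 t0, (Tperm p t)⁻¹ z = (Tperm p t0)⁻¹ z := by
  have : (RfrInv p (z.1 (-1)) z.2).1 0 ≠ t0 := by
    rcases Tinv_res p t0 z with h | h
    · have h' : (RfrInv p (z.1 (-1)) z.2).1 = shiftInv z.2.1 := h
      rw [h']; exact hz _
    · have h' : (RfrInv p (z.1 (-1)) z.2).1 = z.2.1 := h
      rw [h']; exact hz _
  filter_upwards [Kset_eventually t0 _ this] with t ht
  change (shiftInv z.1, ThetaInv t (RfrInv p (z.1 (-1)) z.2)) =
    (shiftInv z.1, ThetaInv t0 (RfrInv p (z.1 (-1)) z.2))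
  by_cases h : (RfrInv p (z.1 (-1)) z.2).1 ∈ Kset t0
  · simp only [ThetaInv, h, ht.2 h]
  · simp only [ThetaInv, h, mt ht.1 h]

lemma good_T (p t0 : I) (z : TotZ B) (hz : ∀ k, z.2.1 k ≠ t0) :
    ∀ k, (Tperm p t0 z).2.1 k ≠ t0 := by
  intro k
  rcases T_res p t0 z with h | h <;> rw [h]
  · exact hz _
  · exact hz _

lemma good_Tinv (p t0 : I) (z : TotZ B) (hz : ∀ k, z.2.1 k ≠ t0) :
    ∀ k, ((Tperm p t0)⁻¹ z).2.1 k ≠ t0 := by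
  intro k
  rcases Tinv_res p t0 z with h | h <;> rw [h]
  · exact hz _
  · exact hz _

lemma Tpow_eventually (p t0 : I) (z : TotZ B) (hz : ∀ k, z.2.1 k ≠ t0) (i : ℤ) :
    (∀ k, ((Tperm p t0 ^ i) z).2.1 k ≠ t0) ∧
      ∀ᶠ t in 𝓝 t0, (Tperm p t ^ i) z = (Tperm p t0 ^ i) z := by
  induction i with
  | zero => exact ⟨by simpa using hz, by simp⟩
  | succ i ih =>
    refine ⟨by rw [zpow_succ_apply]; exact good_T _ _ _ ih.1, ?_⟩
    filter_upwards [ih.2, T_eventually p t0 _ ih.1] with t h1 h2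
    rw [zpow_succ_apply, zpow_succ_apply, h1, h2]
  | pred i ih =>
    refine ⟨by rw [zpow_pred_apply]; exact good_Tinv _ _ _ ih.1, ?_⟩
    filter_upwards [ih.2, Tinv_eventually p t0 _ ih.1] with t h1 h2
    rw [zpow_pred_apply, zpow_pred_apply, h1, h2]

lemma wmap_eventually (p t0 : I) (z : TotZ B) (hz : ∀ k, z.2.1 k ≠ t0) (i : ℤ) :
    ∀ᶠ t in 𝓝 t0, wmap p t z i = wmap p t0 z i := by
  obtain ⟨h1, h2⟩ := Tpow_eventually p t0 z hz i
  filter_upwards [h2, Kset_eventually t0 _ (h1 0)] with t h3 h4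
  simp only [wmap, outf]
  rw [h3]
  by_cases h : ((Tperm p t0 ^ i) z).2.1 ∈ Kset t0
  · rw [if_pos h, if_pos (h4.2 h)]
  · rw [if_neg h, if_neg (mt h4.1 h)]

lemma measurable_Tperm (p t : I) : Measurable (Tperm (B := B) p t) := by
  refine Measurable.prodMk (measurable_shift.comp measurable_fst) ?_
  exact (show Measurable fun z : TotZ B => Function.uncurry (PhiY p t) (z.1 0, z.2) from
    (measurable_Phi p t).comp (((measurable_pi_apply 0).comp measurable_fst).prodMk
    measurable_snd))

lemma measurable_Tperm_inv (p t : I) : Measurable ((Tperm (B := B) p t)⁻¹ : Equiv.Perm _) := by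
  refine Measurable.prodMk (measurable_shiftInv.comp measurable_fst) ?_
  exact (show Measurable fun z : TotZ B => Function.uncurry (PsiY p t) (z.1 (-1), z.2) from
    (measurable_Psi p t).comp (((measurable_pi_apply (-1)).comp measurable_fst).prodMk
    measurable_snd))

lemma measurable_Tpow (p t : I) (i : ℤ) : Measurable (Tperm (B := B) p t ^ i : Equiv.Perm _) := by
  induction i with
  | zero => exact measurable_id
  | succ i ih =>
    rw [zpow_add_one]
    exact ih.comp (measurable_Tperm p t)
  | pred i ih =>
    rw [zpow_sub_one]
    exact ih.comp (measurable_Tperm_inv p t)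

lemma measurable_outf (t : I) : Measurable (outf (B := B) t) := by
  refine Measurable.ite ((measurable_fst.comp measurable_snd) (measurableSet_Kset t)) ?_ ?_
  · exact (measurable_pi_apply 0).comp
      (measurable_snd.comp (measurable_snd.comp measurable_snd))
  · exact (measurable_pi_apply 0).comp
      (measurable_fst.comp (measurable_snd.comp measurable_snd))

lemma measurable_wmap (p t : I) : Measurable (wmap (B := B) p t) :=
  measurable_pi_lambda _ fun i => (measurable_outf t).comp (measurable_Tpow p t i)

lemma measurable_wzero (t : I) : Measurable (wzero (B := B) t) := by
  refine Measurable.ite ((measurable_fst.comp measurable_snd) (measurableSet_Kset t)) ?_ ?_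
  · exact measurable_snd.comp (measurable_snd.comp measurable_snd)
  · exact measurable_fst.comp (measurable_snd.comp measurable_snd)

/-- The measure on the total space. -/
noncomputable abbrev totM (μ ν : ProbabilityMeasure (ℤ → B)) : Measure (TotZ B) :=
  (bern kap).prod (fibM (μ : Measure (ℤ → B)) (ν : Measure (ℤ → B)))

/-- The path of measures. -/
noncomputable def lam (p : I) (μ ν : ProbabilityMeasure (ℤ → B)) (t : I) :
    ProbabilityMeasure (ℤ → B) :=
  ⟨(totM μ ν).map (wmap p t), Measure.isProbabilityMeasure_map (measurable_wmap p t).aemeasurable⟩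

lemma mp_x (μ ν : ProbabilityMeasure (ℤ → B)) :
    MeasurePreserving (fun z : TotZ B => z.2.2.1) (totM μ ν) (μ : Measure (ℤ → B)) :=
  (measurePreserving_fst (μ := (μ : Measure (ℤ → B))) (ν := (ν : Measure (ℤ → B)))).comp
    ((measurePreserving_snd (μ := bern kap)).comp (measurePreserving_snd (μ := bern kap)))

lemma mp_y (μ ν : ProbabilityMeasure (ℤ → B)) :
    MeasurePreserving (fun z : TotZ B => z.2.2.2) (totM μ ν) (ν : Measure (ℤ → B)) :=
  (measurePreserving_snd (μ := (μ : Measure (ℤ → B))) (ν := (ν : Measure (ℤ → B)))).comp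
    ((measurePreserving_snd (μ := bern kap)).comp (measurePreserving_snd (μ := bern kap)))

lemma lam_zero (p : I) (μ ν : ProbabilityMeasure (ℤ → B)) : lam p μ ν 0 = μ := by
  apply Subtype.ext
  change (totM μ ν).map (wmap p 0) = _
  rw [show wmap (B := B) p 0 = fun z => z.2.2.1 from funext fun z => wmap_zero' p z]
  exact (mp_x μ ν).map_eq

lemma lam_one (p : I) (μ ν : ProbabilityMeasure (ℤ → B)) : lam p μ ν 1 = ν := by
  apply Subtype.ext
  change (totM μ ν).map (wmap p 1) = _
  rw [show wmap (B := B) p 1 = fun z => z.2.2.2 from funext fun z => wmap_one p z]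
  exact (mp_y μ ν).map_eq

lemma lam_ergodic {p : I} (hp0 : 0 < p) (hp1 : p < 1) {μ ν : ProbabilityMeasure (ℤ → B)}
    (hμ : Ergodic shift (μ : Measure (ℤ → B))) (hν : Ergodic shift (ν : Measure (ℤ → B))) (t : I) :
    Ergodic shift (lam p μ ν t : Measure (ℤ → B)) := by
  by_cases h0 : t = 0
  · rw [h0, lam_zero]; exact hμ
  by_cases h1 : t = 1
  · rw [h1, lam_one]; exact hν
  have he := skew_ergodic hμ hν hp0 hp1 (unitInterval.pos_iff_ne_zero.2 h0)
    (unitInterval.lt_one_iff_ne_one.2 h1)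
  have hmp : MeasurePreserving (wmap p t) (totM μ ν) (lam p μ ν t : Measure (ℤ → B)) :=
    ⟨measurable_wmap p t, rfl⟩
  refine hmp.ergodic_of_ergodic_semiconj he measurable_shift ?_
  intro z
  exact wmap_T p t z

lemma ae_good (μ ν : ProbabilityMeasure (ℤ → B)) (t0 : I) :
    ∀ᵐ z ∂(totM μ ν), ∀ k, z.2.1 k ≠ t0 := by
  rw [ae_all_iff]
  intro k
  have hmp : MeasurePreserving (fun z : TotZ B => z.2.1 k) (totM μ ν) kap :=
    (measurePreserving_eval_infinitePi (fun _ : ℤ => kap) k).comp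
      ((measurePreserving_fst (ν := (μ : Measure (ℤ → B)).prod (ν : Measure (ℤ → B)))).comp
      (measurePreserving_snd (μ := bern kap)))
  have : ∀ᵐ e ∂kap, e ≠ t0 := by
    rw [ae_iff]; simp
  exact hmp.quasiMeasurePreserving.ae this

variable [TopologicalSpace B] [DiscreteTopology B] [Finite B] [BorelSpace B]

lemma integral_lam (p : I) (μ ν : ProbabilityMeasure (ℤ → B)) (t : I) {f : (ℤ → B) → ℝ}
    (hf : Measurable f) :
    ∫ x, f x ∂(lam p μ ν t : Measure (ℤ → B)) = ∫ z, f (wmap p t z) ∂(totM μ ν) :=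
  integral_map (measurable_wmap p t).aemeasurable hf.aestronglyMeasurable

open scoped BoundedContinuousFunction in
lemma lam_continuous (p : I) (μ ν : ProbabilityMeasure (ℤ → B)) : Continuous (lam p μ ν) := by
  rw [continuous_iff_continuousAt]
  intro t0
  rw [ContinuousAt, ProbabilityMeasure.tendsto_iff_forall_integral_tendsto]
  intro f
  simp only [integral_lam p μ ν _ f.continuous.measurable]
  refine tendsto_integral_filter_of_dominated_convergence (fun _ => ‖f‖) ?_ ?_ ?_ ?_
  · exact Eventually.of_forall fun t =>
      (f.continuous.measurable.comp (measurable_wmap p t)).aestronglyMeasurable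
  · exact Eventually.of_forall fun t => Eventually.of_forall fun z => f.norm_coe_le_norm _
  · exact integrable_const _
  · filter_upwards [ae_good μ ν t0] with z hz
    refine (f.continuous.tendsto _).comp ?_
    rw [tendsto_pi_nhds]
    intro i
    exact tendsto_const_nhds.congr' ((wmap_eventually p t0 z hz i).mono fun t h => h.symm)

lemma integral_wzero (μ ν : ProbabilityMeasure (ℤ → B)) (t : I) {f : (ℤ → B) → ℝ}
    (hf : Measurable f) {C : ℝ} (hC : ∀ x, |f x| ≤ C) :
    ∫ z, f (wzero t z) ∂(totM μ ν) =
      (1 - (bern kap).real (Kset t)) * ∫ x, f x ∂(μ : Measure (ℤ → B)) +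
      (bern kap).real (Kset t) * ∫ x, f x ∂(ν : Measure (ℤ → B)) := by
  have hK : MeasurableSet {z : TotZ B | z.2.1 ∈ Kset t} :=
    (measurable_fst.comp measurable_snd) (measurableSet_Kset t)
  have i1 : Integrable (fun z : TotZ B => f z.2.2.1) (totM μ ν) :=
    integrable_of_bdd (hf.comp (measurable_fst.comp (measurable_snd.comp measurable_snd)))
      (fun z => hC _)
  have i2 : Integrable (fun z : TotZ B => f z.2.2.2) (totM μ ν) :=
    integrable_of_bdd (hf.comp (measurable_snd.comp (measurable_snd.comp measurable_snd)))
      (fun z => hC _)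
  have e1 : ∫ z, f (wzero t z) ∂(totM μ ν) = ∫ y, f (wzero t ((fun _ => 0 : ℤ → I), y))
      ∂(fibM (μ : Measure (ℤ → B)) (ν : Measure (ℤ → B))) := by
    have hm : Measurable fun y : FibY B => f (wzero t ((fun _ => 0 : ℤ → I), y)) :=
      hf.comp ((measurable_wzero t).comp (measurable_const.prodMk measurable_id))
    have := integral_map (μ := totM μ ν) (φ := Prod.snd) measurable_snd.aemeasurable
      (f := fun y : FibY B => f (wzero t ((fun _ => 0 : ℤ → I), y))) hm.aestronglyMeasurable
    rw [(measurePreserving_snd (μ := bern kap)).map_eq] at this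
    rw [this]; rfl
  rw [e1, integral_prod]
  · have e2 : ∀ s : ℤ → I, ∫ y, f (wzero t ((fun _ => 0 : ℤ → I), (s, y)))
        ∂((μ : Measure (ℤ → B)).prod (ν : Measure (ℤ → B))) =
        (∫ x, f x ∂(μ : Measure (ℤ → B))) + (Kset t).indicator (fun _ =>
          (∫ x, f x ∂(ν : Measure (ℤ → B))) - (∫ x, f x ∂(μ : Measure (ℤ → B)))) s := by
      intro s
      by_cases h : s ∈ Kset t
      · simp only [wzero, h, if_true, Set.indicator_of_mem]
        have := integral_map (μ := (μ : Measure (ℤ → B)).prod (ν : Measure (ℤ → B)))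
          (φ := Prod.snd) measurable_snd.aemeasurable (f := f) hf.aestronglyMeasurable
        rw [measurePreserving_snd.map_eq] at this
        rw [← this]; ring
      · simp only [wzero, h, if_false, Set.indicator_of_notMem, not_false_eq_true, add_zero]
        have := integral_map (μ := (μ : Measure (ℤ → B)).prod (ν : Measure (ℤ → B)))
          (φ := Prod.fst) measurable_fst.aemeasurable (f := f) hf.aestronglyMeasurable
        rw [measurePreserving_fst.map_eq] at this
        rw [← this]
    simp only [e2]
    rw [integral_add (integrable_const _)
      ((integrable_const _).indicator (measurableSet_Kset t)),
      integral_indicator (measurableSet_Kset t)]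
    simp
    ring
  · refine integrable_of_bdd (C := C) ?_ (fun y => hC _)
    exact hf.comp ((measurable_wzero t).comp (measurable_const.prodMk measurable_id))

lemma tau_mem (t : I) : 0 ≤ (bern kap).real (Kset t) ∧ (bern kap).real (Kset t) ≤ 1 :=
  ⟨measureReal_nonneg, measureReal_le_one⟩

/-- Uniform continuity on the full shift. -/
lemma unif_cont {f : (ℤ → B) → ℝ} (hf : Continuous f) {δ : ℝ} (hδ : 0 < δ) :
    ∃ n : ℕ, ∀ a b : ℤ → B, (∀ i : ℤ, -n ≤ i → i ≤ n → a i = b i) → |f a - f b| < δ := by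
  set V : ℕ → Set ((ℤ → B) × (ℤ → B)) := fun n => {q | ∀ i : ℤ, -n ≤ i → i ≤ n → q.1 i = q.2 i}
  have hcl : ∀ n, IsClosed (V n) := by
    intro n
    have : V n = ⋂ i : ℤ, ⋂ (_ : -n ≤ i), ⋂ (_ : i ≤ n),
        {q : (ℤ → B) × (ℤ → B) | q.1 i = q.2 i} := by
      ext q; simp [V]
    rw [this]
    refine isClosed_iInter fun i => isClosed_iInter fun _ => isClosed_iInter fun _ => ?_
    exact isClosed_eq ((continuous_apply i).comp continuous_fst)
      ((continuous_apply i).comp continuous_snd)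
  obtain ⟨n, hn⟩ := exists_subset_nhds_of_isCompact' (V := V)
    (U := {q | |f q.1 - f q.2| < δ})
    (fun m n => ⟨max m n, fun q hq i h1 h2 => hq i (by push_cast; omega) (by push_cast; omega),
      fun q hq i h1 h2 => hq i (by push_cast; omega) (by push_cast; omega)⟩)
    (fun n => (hcl n).isCompact) hcl (by
      intro q hq
      have : q.1 = q.2 := by
        funext i
        exact Set.mem_iInter.1 hq i.natAbs i (by omega) (by omega)
      refine IsOpen.mem_nhds ?_ ?_
      · exact isOpen_lt (((hf.comp continuous_fst).sub (hf.comp continuous_snd)).abs)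
          continuous_const
      · simp [this, hδ])
  exact ⟨n, fun a b hab => hn (show (a, b) ∈ V n from hab)⟩

end Path

section PathB

open unitInterval
open scoped BoundedContinuousFunction

variable {B : Type*} [MeasurableSpace B] [TopologicalSpace B] [DiscreteTopology B] [Finite B]
  [BorelSpace B]

/-- The set of driver sequences with a refresh in the window. -/
def badS (B : Type*) (p : I) (n : ℕ) : Set (TotZ B) :=
  ⋃ i ∈ Finset.Icc (-(n : ℤ)) n, {z | z.1 i < p}

lemma measurableSet_badS (p : I) (n : ℕ) : MeasurableSet (badS B p n) := by
  refine Finset.measurableSet_biUnion _ fun i _ => ?_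
  exact ((measurable_pi_apply i).comp measurable_fst) measurableSet_Iio

lemma badS_le (μ ν : ProbabilityMeasure (ℤ → B)) (p : I) (n : ℕ) :
    (totM μ ν).real (badS B p n) ≤ (2 * n + 1) * p := by
  refine (measureReal_biUnion_finset_le _ _).trans ?_
  have : ∀ i ∈ Finset.Icc (-(n : ℤ)) n, (totM μ ν).real {z : TotZ B | z.1 i < p} = p := by
    intro i _
    have hmp : MeasurePreserving (fun z : TotZ B => z.1 i) (totM μ ν) kap :=
      (measurePreserving_eval_infinitePi (fun _ : ℤ => kap) i).comp measurePreserving_fst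
    have := hmp.measure_preimage (s := Set.Iio p) measurableSet_Iio.nullMeasurableSet
    rw [kap_Iio] at this
    rw [measureReal_def]
    change ((totM μ ν) ((fun z : TotZ B => z.1 i) ⁻¹' Set.Iio p)).toReal = p
    rw [this, ENNReal.toReal_ofReal p.2.1]
  rw [Finset.sum_congr rfl this]
  simp only [Finset.sum_const, Int.card_Icc, nsmul_eq_mul]
  have : ((n : ℤ) + 1 - -(n : ℤ)).toNat = 2 * n + 1 := by omega
  rw [this]; push_cast; exact le_rfl

lemma lam_close (μ ν : ProbabilityMeasure (ℤ → B)) (f : (ℤ → B) →ᵇ ℝ) {δ : ℝ} (hδ : 0 < δ) :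
    ∀ᶠ p in 𝓝[>] (0 : I), ∀ t : I, |∫ x, f x ∂(lam p μ ν t : Measure (ℤ → B)) -
      ((1 - (bern kap).real (Kset t)) * ∫ x, f x ∂(μ : Measure (ℤ → B)) +
      (bern kap).real (Kset t) * ∫ x, f x ∂(ν : Measure (ℤ → B)))| < δ := by
  obtain ⟨n, hn⟩ := unif_cont f.continuous (half_pos hδ)
  have hlim : Tendsto (fun p : I => 2 * ‖f‖ * ((2 * n + 1) * (p : ℝ))) (𝓝[>] (0 : I)) (𝓝 0) := by
    have : Continuous fun p : I => 2 * ‖f‖ * ((2 * n + 1) * (p : ℝ)) := by fun_prop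
    have h := this.tendsto 0
    simp only [Set.Icc.coe_zero, mul_zero] at h
    exact h.mono_left nhdsWithin_le_nhds
  filter_upwards [hlim.eventually (eventually_lt_nhds (half_pos hδ))] with p hp t
  have hfb : ∀ x, |f x| ≤ ‖f‖ := fun x => f.norm_coe_le_norm x
  rw [← integral_wzero μ ν t f.continuous.measurable hfb,
    integral_lam p μ ν t f.continuous.measurable]
  have i1 : Integrable (fun z : TotZ B => f (wmap p t z)) (totM μ ν) :=
    integrable_of_bdd (f.continuous.measurable.comp (measurable_wmap p t)) (fun z => hfb _)
  have i2 : Integrable (fun z : TotZ B => f (wzero t z)) (totM μ ν) :=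
    integrable_of_bdd (f.continuous.measurable.comp (measurable_wzero t)) (fun z => hfb _)
  rw [← integral_sub i1 i2]
  have hS := measurableSet_badS (B := B) p n
  have hb : ∀ z : TotZ B, ‖f (wmap p t z) - f (wzero t z)‖ ≤
      δ / 2 + (badS B p n).indicator (fun _ => 2 * ‖f‖) z := by
    intro z
    by_cases hz : z ∈ badS B p n
    · rw [Set.indicator_of_mem hz]
      have h1 := norm_sub_le (f (wmap p t z)) (f (wzero t z))
      have h2 := f.norm_coe_le_norm (wmap p t z)
      have h3 := f.norm_coe_le_norm (wzero t z)
      linarith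
    · rw [Set.indicator_of_notMem hz, add_zero]
      refine (hn _ _ fun i h1 h2 => wmap_eq_wzero p t z n ?_ i h1 h2).le
      intro i h1 h2
      by_contra hlt
      exact hz (Set.mem_biUnion (Finset.mem_coe.2 (Finset.mem_Icc.2 ⟨h1, h2⟩)) (not_le.1 hlt))
  have i3 : Integrable (fun z : TotZ B => δ / 2 + (badS B p n).indicator (fun _ => 2 * ‖f‖) z)
      (totM μ ν) := (integrable_const _).add ((integrable_const _).indicator hS)
  calc |∫ z, f (wmap p t z) - f (wzero t z) ∂(totM μ ν)|
      ≤ ∫ z, δ / 2 + (badS B p n).indicator (fun _ => 2 * ‖f‖) z ∂(totM μ ν) :=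
        norm_integral_le_of_norm_le i3 (Eventually.of_forall hb)
    _ = δ / 2 + (totM μ ν).real (badS B p n) * (2 * ‖f‖) := by
        rw [integral_add (integrable_const _) ((integrable_const _).indicator hS),
          integral_indicator hS]
        simp
    _ < δ := by
        have := badS_le μ ν p n
        have h2 : (totM μ ν).real (badS B p n) * (2 * ‖f‖) ≤ (2 * n + 1) * p * (2 * ‖f‖) :=
          mul_le_mul_of_nonneg_right this (by positivity)
        linarith

/-- Ergodic measures with nonnegative drift. -/
def Eset (g : B → ℝ) : Set (ProbabilityMeasure (ℤ → B)) :=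
  {ρ | Ergodic shift (ρ : Measure (ℤ → B)) ∧ 0 ≤ ∫ x, g (x 0) ∂(ρ : Measure (ℤ → B))}

lemma lam_mem_Eset {g : B → ℝ} {p : I} (hp0 : 0 < p) (hp1 : p < 1)
    {μ ν : ProbabilityMeasure (ℤ → B)} (hμ : μ ∈ Eset g) (hν : ν ∈ Eset g) (t : I) :
    lam p μ ν t ∈ Eset g := by
  refine ⟨lam_ergodic hp0 hp1 hμ.1 hν.1 t, ?_⟩
  have hg : Measurable fun x : ℤ → B => g (x 0) :=
    ((continuous_of_discreteTopology (f := g)).comp (continuous_apply 0)).measurable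
  obtain ⟨C, hC⟩ : ∃ C, ∀ b, |g b| ≤ C := by
    obtain ⟨C, hC⟩ := (Set.finite_range fun b => |g b|).bddAbove
    exact ⟨C, fun b => hC ⟨b, rfl⟩⟩
  rw [integral_lam p μ ν t (f := fun x => g (x 0)) hg]
  simp only [wmap_zero]
  rw [integral_wzero μ ν t (f := fun x => g (x 0)) hg (C := C) (fun x => hC _)]
  have := tau_mem t
  have h1 := hμ.2
  have h2 := hν.2
  have := this.1
  have : 0 ≤ 1 - (bern kap).real (Kset t) := by linarith [(tau_mem t).2]
  positivity

lemma joined_lam {g : B → ℝ} {p : I} (hp0 : 0 < p) (hp1 : p < 1)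
    {V : Set (ProbabilityMeasure (ℤ → B))}
    (μ ν : ↥(Eset g)) (hV : ∀ t, lam p μ.1 ν.1 t ∈ V) :
    JoinedIn (Subtype.val ⁻¹' V : Set ↥(Eset g)) μ ν := by
  refine ⟨⟨⟨fun t => ⟨lam p μ.1 ν.1 t, lam_mem_Eset hp0 hp1 μ.2 ν.2 t⟩,
    (lam_continuous p μ.1 ν.1).subtype_mk _⟩, ?_, ?_⟩, fun t => hV t⟩
  · exact Subtype.ext (lam_zero p _ _)
  · exact Subtype.ext (lam_one p _ _)

lemma half_I : (0 : I) < ⟨1 / 2, by norm_num, by norm_num⟩ ∧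
    (⟨1 / 2, by norm_num, by norm_num⟩ : I) < 1 := by
  constructor
  · exact Subtype.mk_lt_mk.2 (by norm_num)
  · exact Subtype.mk_lt_mk.2 (by norm_num)

theorem Eset_pathConnected {g : B → ℝ} (hne : (Eset g).Nonempty) :
    PathConnectedSpace ↥(Eset g) := by
  refine ⟨⟨⟨hne.some, hne.some_mem⟩⟩, fun μ ν => ?_⟩
  have := joined_lam (V := Set.univ) half_I.1 half_I.2 μ ν (fun _ => trivial)
  exact this.joined

lemma pm_nhds_basis {X : Type*} [TopologicalSpace X] [MeasurableSpace X] [OpensMeasurableSpace X]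
    (ρ : ProbabilityMeasure X) {U : Set (ProbabilityMeasure X)} (hU : U ∈ 𝓝 ρ) :
    ∃ (F : Finset (X →ᵇ ℝ)) (ε : ℝ), 0 < ε ∧
      {η : ProbabilityMeasure X | ∀ f ∈ F, |∫ x, f x ∂(η : Measure X) - ∫ x, f x ∂(ρ : Measure X)| < ε} ⊆ U := by
  classical
  set ev : ProbabilityMeasure X → (X →ᵇ ℝ) → ℝ := fun η f => ∫ x, f x ∂(η : Measure X)
  have hle : comap ev (𝓝 (ev ρ)) ≤ 𝓝 ρ := by
    have : Tendsto (fun η : ProbabilityMeasure X => η) (comap ev (𝓝 (ev ρ))) (𝓝 ρ) := by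
      rw [ProbabilityMeasure.tendsto_iff_forall_integral_tendsto]
      intro f
      have := (tendsto_comap (f := ev) (x := 𝓝 (ev ρ)))
      rw [tendsto_pi_nhds] at this
      exact this f
    exact this
  have h1 := hle hU
  rw [mem_comap] at h1
  obtain ⟨W, hW, hWU⟩ := h1
  rw [nhds_pi, Filter.mem_pi] at hW
  obtain ⟨J, hI, t, ht, htW⟩ := hW
  have : ∀ f, ∃ ε > 0, Metric.ball (ev ρ f) ε ⊆ t f := fun f => Metric.mem_nhds_iff.1 (ht f)
  choose ε hε hb using this
  have : ∃ δ : ℝ, 0 < δ ∧ ∀ f ∈ hI.toFinset, δ ≤ ε f := by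
    have : ∀ᶠ δ in 𝓝[>] (0:ℝ), ∀ f ∈ hI.toFinset, δ ≤ ε f := by
      rw [eventually_all_finset]
      intro f _
      exact (eventually_le_nhds (hε f)).filter_mono nhdsWithin_le_nhds
    obtain ⟨δ, h1, h2⟩ := (this.and self_mem_nhdsWithin).exists
    exact ⟨δ, h2, h1⟩
  obtain ⟨δ, hδ, hδ'⟩ := this
  refine ⟨hI.toFinset, δ, hδ, fun η hη => hWU (htW fun f hf => hb f ?_)⟩
  have hf' := hI.mem_toFinset.2 hf
  rw [Metric.mem_ball, Real.dist_eq]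
  exact (hη f hf').trans_le (hδ' f hf')

lemma pm_nhds_mem {X : Type*} [TopologicalSpace X] [MeasurableSpace X] [OpensMeasurableSpace X]
    (ρ : ProbabilityMeasure X) (F : Finset (X →ᵇ ℝ)) {ε : ℝ} (hε : 0 < ε) :
    {η : ProbabilityMeasure X | ∀ f ∈ F, |∫ x, f x ∂(η : Measure X) - ∫ x, f x ∂(ρ : Measure X)| < ε}
      ∈ 𝓝 ρ := by
  change ∀ᶠ η : ProbabilityMeasure X in 𝓝 ρ, ∀ f ∈ F, |∫ x, f x ∂(η : Measure X) - ∫ x, f x ∂(ρ : Measure X)| < ε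
  rw [eventually_all_finset]
  intro f _
  have h := (ProbabilityMeasure.tendsto_iff_forall_integral_tendsto.1
    (tendsto_id (x := 𝓝 ρ))) f
  have := (Metric.tendsto_nhds.1 h) ε hε
  exact this

theorem Eset_locPathConnected {g : B → ℝ} : LocPathConnectedSpace ↥(Eset g) := by
  classical
  refine ⟨fun ρ => ⟨fun U => ⟨fun hU => ?_, fun ⟨s, hs, hsU⟩ => mem_of_superset hs.1 hsU⟩⟩⟩
  rw [nhds_subtype_eq_comap, mem_comap] at hU
  obtain ⟨W, hW, hWU⟩ := hU
  obtain ⟨F, ε, hε, hF⟩ := pm_nhds_basis ρ.1 hW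
  set V := {η : ProbabilityMeasure (ℤ → B) | ∀ f ∈ F,
    |∫ x, f x ∂(η : Measure (ℤ → B)) - ∫ x, f x ∂(ρ.1 : Measure (ℤ → B))| < ε} with hVdef
  have hVn : V ∈ 𝓝 ρ.1 := pm_nhds_mem ρ.1 F hε
  refine ⟨Subtype.val ⁻¹' V, ⟨(continuous_subtype_val.tendsto ρ) hVn, ?_⟩, (Set.preimage_mono hF).trans hWU⟩
  refine isPathConnected_iff.2 ⟨⟨ρ, show ρ.1 ∈ V from mem_of_mem_nhds hVn⟩, fun μ hμ ν hν => ?_⟩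
  have hcomb : ∀ f ∈ F, ∀ᶠ p in 𝓝[>] (0 : I), ∀ t : I,
      |∫ x, f x ∂(lam p μ.1 ν.1 t : Measure (ℤ → B)) - ∫ x, f x ∂(ρ.1 : Measure (ℤ → B))| < ε := by
    intro f hf
    have a1 := hμ f hf
    have a2 := hν f hf
    set a := ∫ x, f x ∂(μ.1 : Measure (ℤ → B))
    set b := ∫ x, f x ∂(ν.1 : Measure (ℤ → B))
    set c := ∫ x, f x ∂(ρ.1 : Measure (ℤ → B))
    have hd : 0 < ε - max |a - c| |b - c| := sub_pos.2 (max_lt a1 a2)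
    filter_upwards [lam_close μ.1 ν.1 f hd] with p hp t
    have h := hp t
    obtain ⟨t1, t2⟩ := tau_mem t
    set τ := (bern kap).real (Kset t)
    have h3 : |(1 - τ) * a + τ * b - c| ≤ max |a - c| |b - c| := by
      have : (1 - τ) * a + τ * b - c = (1 - τ) * (a - c) + τ * (b - c) := by ring
      rw [this]
      refine (abs_add_le _ _).trans ?_
      rw [abs_mul, abs_mul, abs_of_nonneg t1, abs_of_nonneg (by linarith : 0 ≤ 1 - τ)]
      have m1 := mul_le_mul_of_nonneg_left (le_max_left |a - c| |b - c|)
        (by linarith : 0 ≤ 1 - τ)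
      have m2 := mul_le_mul_of_nonneg_left (le_max_right |a - c| |b - c|) t1
      linarith
    have h4 := abs_sub_le (∫ x, f x ∂(lam p μ.1 ν.1 t : Measure (ℤ → B)))
      ((1 - τ) * a + τ * b) c
    change |_| < _ at h
    linarith
  have hall := (eventually_all_finset F).2 hcomb
  have hlt1 : ∀ᶠ p in 𝓝[>] (0 : I), p < 1 :=
    (eventually_lt_nhds (zero_lt_one)).filter_mono nhdsWithin_le_nhds
  have : (𝓝[>] (0 : I)).NeBot := by
    rw [← mem_closure_iff_nhdsWithin_neBot]
    rw [closure_Ioi' ⟨1, zero_lt_one⟩]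
    exact Set.mem_Ici.2 le_rfl
  obtain ⟨p, ⟨h1, h2⟩, h3⟩ := ((hall.and hlt1).and self_mem_nhdsWithin).exists
  exact joined_lam h3 h2 μ ν fun t f hf => h1 f hf t

end PathB

section Heights

variable {M N : ℕ}

lemma Hfun_zero (x : ℤ → DMSym M N) : Hfun x 0 = 0 := by simp [Hfun]

lemma Hfun_succ (x : ℤ → DMSym M N) (i : ℤ) : Hfun x (i + 1) = Hfun x i + Gfun x i := by
  by_cases h : 0 ≤ i
  · obtain ⟨n, rfl⟩ := Int.eq_ofNat_of_zero_le h
    have h1 : (0 : ℤ) ≤ (n : ℤ) + 1 := by omega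
    have h2 : ((n : ℤ) + 1).toNat = n + 1 := by omega
    simp only [Hfun, h1, h2, if_true, Int.natCast_nonneg, Int.toNat_natCast]
    rw [Finset.sum_range_succ]
  · obtain ⟨n, hn⟩ : ∃ n : ℕ, i = -(n : ℤ) - 1 := ⟨(-i - 1).toNat, by omega⟩
    subst hn
    have h3 : (-(-(n : ℤ) - 1)).toNat = n + 1 := by omega
    have e1 : Hfun x (-(n : ℤ) - 1) =
        -∑ j ∈ Finset.range (n + 1), Gfun x (-(n : ℤ) - 1 + (j : ℤ)) := by
      simp only [Hfun, h, if_false, h3]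
    have e2 : Hfun x (-(n : ℤ) - 1 + 1) =
        -∑ j ∈ Finset.range n, Gfun x (-(n : ℤ) + (j : ℤ)) := by
      rw [show -(n : ℤ) - 1 + 1 = -(n : ℤ) by ring]
      by_cases hn : n = 0
      · subst hn; simp [Hfun]
      · have : ¬ (0 : ℤ) ≤ -(n : ℤ) := by omega
        simp only [Hfun, this, if_false, neg_neg, Int.toNat_natCast]
    rw [e1, e2, Finset.sum_range_succ']
    have : ∀ j ∈ Finset.range n, Gfun x (-(n : ℤ) - 1 + ((j + 1 : ℕ) : ℤ)) =
        Gfun x (-(n : ℤ) + (j : ℤ)) := fun j _ => congrArg _ (by push_cast; ring)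
    rw [Finset.sum_congr rfl this]
    simp

lemma height_unique {h h' : ℤ → ℤ} (H : ∀ i, h (i + 1) - h i = h' (i + 1) - h' i) (i : ℤ) :
    h i - h 0 = h' i - h' 0 := by
  induction i with
  | zero => simp
  | succ i ih => have := H i; linarith
  | pred i ih => have := H (-i - 1); simp only [sub_add_cancel] at this; linarith

lemma Hfun_shift (x : ℤ → DMSym M N) (c i : ℤ) :
    Hfun (fun k => x (k + c)) i = Hfun x (i + c) - Hfun x c := by
  have := height_unique (h := Hfun (fun k => x (k + c))) (h' := fun i => Hfun x (i + c))
    (fun i => by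
      beta_reduce
      rw [Hfun_succ, show i + 1 + c = (i + c) + 1 by ring, Hfun_succ]
      simp only [Gfun]; ring) i
  simp only [Hfun_zero, zero_add] at this
  linarith

lemma Hfun_congr {x x' : ℤ → DMSym M N} (h : ∀ i, Gfun x i = Gfun x' i) : Hfun x = Hfun x' := by
  funext i
  have := height_unique (h := Hfun x) (h' := Hfun x')
    (fun i => by rw [Hfun_succ, Hfun_succ, h i]; ring) i
  simp only [Hfun_zero] at this
  linarith

lemma Gfun_le (x : ℤ → DMSym M N) (i : ℤ) : |Gfun x i| ≤ 1 := by
  unfold Gfun; cases x i <;> simp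

/-- Position `j` is the left partner of position `i`. -/
def IsMatch (h : ℤ → ℤ) (j i : ℤ) : Prop :=
  j < i ∧ h j = h (i + 1) ∧ ∀ k, j < k → k ≤ i → h j < h k

lemma IsMatch.unique {h : ℤ → ℤ} {j j' i : ℤ} (h1 : IsMatch h j i) (h2 : IsMatch h j' i) :
    j = j' := by
  rcases lt_trichotomy j j' with hlt | heq | hlt
  · have := h1.2.2 j' hlt h2.1.le
    have a := h1.2.1; have b := h2.2.1; omega
  · exact heq
  · have := h2.2.2 j hlt h1.1.le
    have a := h1.2.1; have b := h2.2.1; omega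

lemma exists_match (x : ℤ → DMSym M N) {i : ℤ} (hi : Gfun x i = -1) {k : ℤ} (hk : k ≤ i)
    (hki : Hfun x k ≤ Hfun x (i + 1)) : ∃ j, IsMatch (Hfun x) j i := by
  obtain ⟨j, ⟨hj1, hj2⟩, hj3⟩ := Int.exists_greatest_of_bdd
    (P := fun j => j ≤ i ∧ Hfun x j ≤ Hfun x (i + 1)) ⟨i, fun z hz => hz.1⟩ ⟨k, hk, hki⟩
  have hs := Hfun_succ x i
  have hji : j ≠ i := by rintro rfl; omega
  have hlt : j < i := lt_of_le_of_ne hj1 hji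
  have hgt : ∀ l, j < l → l ≤ i → Hfun x (i + 1) < Hfun x l := by
    intro l h1 h2
    by_contra hc
    have := hj3 l ⟨h2, not_lt.1 hc⟩
    omega
  have h1 := hgt (j + 1) (by omega) (by omega)
  have h2 := Hfun_succ x j
  have h3 := (abs_le.1 (Gfun_le x j)).2
  have heq : Hfun x j = Hfun x (i + 1) := by omega
  exact ⟨j, hlt, heq, fun l a b => by rw [heq]; exact hgt l a b⟩

lemma IsMatch.left {x : ℤ → DMSym M N} {j i : ℤ} (h : IsMatch (Hfun x) j i) :
    ∃ a, x j = .la a := by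
  have h1 := h.2.2 (j + 1) (by omega) (by have := h.1; omega)
  rw [Hfun_succ] at h1
  unfold Gfun at h1
  rcases hx : x j with a | a | a
  · exact ⟨a, rfl⟩
  all_goals rw [hx] at h1; simp at h1

/-- Partial reductions. -/
def partR (x : ℤ → DMSym M N) (j : ℤ) (n : ℕ) : DyckElem M :=
  red ((List.range n).map fun m => x (j + m))

lemma partR_zero (x : ℤ → DMSym M N) (j : ℤ) : partR x j 0 = some ([], []) := rfl

lemma partR_succ (x : ℤ → DMSym M N) (j : ℤ) (n : ℕ) :
    partR x j (n + 1) = dyckStep (partR x j n) (x (j + n)) := by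
  simp [partR, red, List.range_succ]

lemma red_wordAt (x : ℤ → DMSym M N) (j k : ℤ) :
    red (wordAt x j k) = partR x j (k + 1 - j).toNat := rfl

lemma partR_ne_none {x : ℤ → DMSym M N} {j : ℤ} {n : ℕ} (h : partR x j (n + 1) ≠ none) :
    partR x j n ≠ none := by
  intro h'; rw [partR_succ, h'] at h; exact h rfl

lemma partR_ne_none' {x : ℤ → DMSym M N} {j : ℤ} {n m : ℕ} (hnm : n ≤ m)
    (h : partR x j m ≠ none) : partR x j n ≠ none := by
  induction m, hnm using Nat.le_induction with
  | base => exact h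
  | succ m _ ih => exact ih (partR_ne_none h)

/-- The index-matching condition. -/
def Matched (x : ℤ → DMSym M N) : Prop :=
  ∀ j i a b, IsMatch (Hfun x) j i → x j = .la a → x i = .ra b → a = b

lemma matched_of_mem {x : ℤ → DMSym M N} (hx : x ∈ SigmaD M N) : Matched x := by
  intro j i a b hm hja hib
  have hr := hx j i hm.1
  rw [red_wordAt] at hr
  obtain ⟨d, hd⟩ : ∃ d : ℕ, i = j + 1 + d := ⟨(i - (j + 1)).toNat, by have := hm.1; omega⟩
  rw [show (i + 1 - j).toNat = d + 1 + 1 by omega] at hr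
  have key : ∀ n ≤ d, ∃ e : List (Fin M), partR x j (n + 1) = some ([], a :: e) ∧
      (e.length : ℤ) = Hfun x (j + 1 + n) - Hfun x (j + 1) := by
    intro n
    induction n with
    | zero =>
      intro _
      refine ⟨[], ?_, by simp⟩
      rw [partR_succ, partR_zero]; simp [hja, dyckStep]
    | succ n ih =>
      intro hn
      obtain ⟨e, he, hl⟩ := ih (by omega)
      have hne : partR x j (n + 1 + 1) ≠ none := partR_ne_none' (by omega) hr
      have hge := hm.2.2 (j + 1 + (n + 1 : ℕ)) (by omega) (by omega)
      rw [partR_succ, he] at hne ⊢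
      rw [show j + ((n + 1 : ℕ) : ℤ) = j + 1 + n by push_cast; ring] at hne ⊢
      rw [show j + 1 + ((n + 1 : ℕ) : ℤ) = j + 1 + n + 1 by push_cast; ring] at hge ⊢
      rw [Hfun_succ] at hge ⊢
      have hj1 : Hfun x (j + 1) = Hfun x j + 1 := by rw [Hfun_succ]; simp [Gfun, hja]
      unfold Gfun at hge ⊢
      rcases hc : x (j + 1 + n) with c | c | c
      · refine ⟨e ++ [c], by simp [dyckStep], ?_⟩
        simp; omega
      · refine ⟨e, by simp [dyckStep], ?_⟩
        simp; omega
      · rw [hc] at hge hne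
        simp only at hge
        rcases List.eq_nil_or_concat e with rfl | ⟨e', d', rfl⟩
        · simp at hl; omega
        · have hg : (a :: (e' ++ [d'])).getLast? = some d' := by
            rw [← List.cons_append, List.getLast?_concat]
          have hdl : (a :: (e' ++ [d'])).dropLast = a :: e' := by
            rw [← List.cons_append, List.dropLast_concat]
          by_cases hdc : d' = c
          · subst hdc
            refine ⟨e', ?_, ?_⟩
            · simp only [dyckStep, List.concat_eq_append, hg, hdl, if_true]
            · simp at hl ⊢; omega
          · exfalso; apply hne
            simp only [dyckStep, List.concat_eq_append, hg, hdc, if_false]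
  obtain ⟨e, he, hl⟩ := key d le_rfl
  have hi : Hfun x i = Hfun x j + 1 := by
    have := Hfun_succ x i
    have h2 := hm.2.1
    have : Gfun x i = -1 := by simp [Gfun, hib]
    omega
  have hj1 : Hfun x (j + 1) = Hfun x j + 1 := by rw [Hfun_succ]; simp [Gfun, hja]
  rw [← hd, hi, hj1] at hl
  have he0 : e = [] := by
    apply List.eq_nil_of_length_eq_zero; omega
  subst he0
  rw [partR_succ, he, show j + ((d + 1 : ℕ) : ℤ) = i by push_cast; omega, hib] at hr
  by_contra hab
  apply hr
  simp [dyckStep, hab]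

lemma mem_of_matched {x : ℤ → DMSym M N} (hx : Matched x) : x ∈ SigmaD M N := by
  have key : ∀ (j : ℤ) (n : ℕ), ∃ bs as, partR x j n = some (bs, as) ∧
      ∀ (m : ℕ) a, as[m]? = some a → ∃ l, l < j + n ∧ x l = .la a ∧
        Hfun x l = Hfun x (j + n) - as.length + m ∧ ∀ k, l < k → k ≤ j + n → Hfun x l < Hfun x k := by
    intro j n
    induction n with
    | zero => exact ⟨[], [], rfl, by simp⟩
    | succ n ih =>
      obtain ⟨bs, as, he, hI⟩ := ih
      rw [partR_succ, he, show j + ((n + 1 : ℕ) : ℤ) = j + n + 1 by push_cast; ring]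
      generalize hp : j + (n : ℤ) = p at *
      have hs := Hfun_succ x p
      unfold Gfun at hs
      rcases hc : x p with c | c | c
      · rw [hc] at hs; simp only at hs
        refine ⟨bs, as ++ [c], by simp [dyckStep], ?_⟩
        intro m a hma
        rcases lt_or_ge m as.length with hm | hm
        · rw [List.getElem?_append_left hm] at hma
          obtain ⟨l, h1, h2, h3, h4⟩ := hI m a hma
          refine ⟨l, by omega, h2, by simp; omega, ?_⟩
          intro k hk1 hk2
          rcases eq_or_lt_of_le hk2 with rfl | hlt
          · have := h4 p h1 le_rfl; omega
          · exact h4 k hk1 (by omega)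
        · rw [List.getElem?_append_right hm] at hma
          have hm' : m = as.length := by
            by_contra hne
            have : m - as.length = (m - as.length - 1) + 1 := by omega
            rw [this] at hma; simp at hma
          subst hm'
          simp at hma; subst hma
          refine ⟨p, by omega, hc, by simp; omega, ?_⟩
          intro k hk1 hk2
          have : k = p + 1 := by omega
          subst this; omega
      · rw [hc] at hs; simp only [add_zero] at hs
        refine ⟨bs, as, by simp [dyckStep], ?_⟩
        intro m a hma
        obtain ⟨l, h1, h2, h3, h4⟩ := hI m a hma
        refine ⟨l, by omega, h2, by omega, ?_⟩
        intro k hk1 hk2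
        rcases eq_or_lt_of_le hk2 with rfl | hlt
        · have := h4 p h1 le_rfl; omega
        · exact h4 k hk1 (by omega)
      · rw [hc] at hs; simp only at hs
        rcases List.eq_nil_or_concat as with rfl | ⟨as', d, rfl⟩
        · exact ⟨bs ++ [c], [], by simp [dyckStep], by simp⟩
        · rw [List.concat_eq_append] at hI ⊢
          obtain ⟨l, h1, h2, h3, h4⟩ := hI as'.length d (by simp)
          simp only [List.length_append, List.length_singleton] at h3 hI
          have hdc : d = c := by
            refine hx l p d c ⟨h1, by push_cast at h3; omega, h4⟩ h2 hc
          subst hdc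
          refine ⟨bs, as', by simp [dyckStep], ?_⟩
          intro m a hma
          have hm : m < as'.length := (List.getElem?_eq_some_iff.1 hma).1
          obtain ⟨l, h1, h2, h3, h4⟩ := hI m a (by rw [List.getElem?_append_left hm]; exact hma)
          push_cast at h3
          refine ⟨l, by omega, h2, by omega, ?_⟩
          intro k hk1 hk2
          rcases eq_or_lt_of_le hk2 with rfl | hlt
          · omega
          · exact h4 k hk1 (by omega)
  intro j k _
  rw [red_wordAt]
  obtain ⟨bs, as, h, _⟩ := key j (k + 1 - j).toNat
  rw [h]; simp

end Heights

/-- The alphabet in which all right brackets are identified. -/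
inductive BSym (M N : ℕ) : Type where
  | la : Fin M → BSym M N
  | u : Fin N → BSym M N
  | r : BSym M N

namespace BSym

variable {M N : ℕ}

instance : TopologicalSpace (BSym M N) := ⊥
instance : DiscreteTopology (BSym M N) := ⟨rfl⟩
instance : MeasurableSpace (BSym M N) := ⊤
instance : BorelSpace (BSym M N) := ⟨borel_eq_top_of_discrete.symm⟩

/-- Forget the index of right brackets. -/
def forget : DMSym M N → BSym M N
  | .la k => .la k
  | .u k => .u k
  | .ra _ => .r

/-- A section of `forget`. -/
def lift [NeZero M] : BSym M N → DMSym M N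
  | .la k => .la k
  | .u k => .u k
  | .r => .ra 0

instance [NeZero M] : Finite (BSym M N) :=
  Finite.of_surjective forget (fun b => ⟨lift b, by cases b <;> rfl⟩)

end BSym

section Lift

variable {M N : ℕ} [NeZero M]

/-- Height of a sequence over the small alphabet. -/
def HB (y : ℤ → BSym M N) : ℤ → ℤ := Hfun fun i => BSym.lift (y i)

/-- Increments. -/
def GB (b : BSym M N) : ℤ :=
  match b with
  | .la _ => 1
  | .u _ => 0
  | .r => -1

lemma Gfun_lift (y : ℤ → BSym M N) (i : ℤ) : Gfun (fun i => BSym.lift (y i)) i = GB (y i) := by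
  simp only [Gfun, GB]; cases y i <;> rfl

lemma Gfun_forget (x : ℤ → DMSym M N) (i : ℤ) : Gfun x i = GB (BSym.forget (x i)) := by
  simp only [Gfun, GB]; cases x i <;> rfl

lemma HB_succ (y : ℤ → BSym M N) (i : ℤ) : HB y (i + 1) = HB y i + GB (y i) := by
  rw [HB, Hfun_succ, Gfun_lift]

lemma HB_zero (y : ℤ → BSym M N) : HB y 0 = 0 := Hfun_zero _

lemma HB_shift (y : ℤ → BSym M N) (c i : ℤ) :
    HB (fun k => y (k + c)) i = HB y (i + c) - HB y c :=
  Hfun_shift (fun i => BSym.lift (y i)) c i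

lemma HB_forget (x : ℤ → DMSym M N) : HB (fun i => BSym.forget (x i)) = Hfun x :=
  Hfun_congr fun i => by rw [Gfun_lift, Gfun_forget]

/-- The partner of `i` carries the label `a`. -/
def Lab (y : ℤ → BSym M N) (i : ℤ) (a : Fin M) : Prop :=
  ∃ j, IsMatch (HB y) j i ∧ y j = .la a

lemma Lab.unique {y : ℤ → BSym M N} {i : ℤ} {a b : Fin M} (h1 : Lab y i a) (h2 : Lab y i b) :
    a = b := by
  obtain ⟨j, hj, ha⟩ := h1
  obtain ⟨j', hj', hb⟩ := h2
  have := hj.unique hj'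
  subst this
  rw [ha] at hb
  exact BSym.la.inj hb

open Classical in
/-- The label of a right bracket. -/
noncomputable def labf (y : ℤ → BSym M N) (i : ℤ) : Fin M :=
  if h : ∃ a, Lab y i a then h.choose else 0

lemma labf_eq {y : ℤ → BSym M N} {i : ℤ} {a : Fin M} (h : Lab y i a) : labf y i = a := by
  have h' : ∃ a, Lab y i a := ⟨a, h⟩
  rw [labf, dif_pos h']
  exact h'.choose_spec.unique h

lemma labf_eq_zero {y : ℤ → BSym M N} {i : ℤ} (h : ¬ ∃ a, Lab y i a) : labf y i = 0 := by
  rw [labf, dif_neg h]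

/-- The lifting map. -/
noncomputable def psi0 (y : ℤ → BSym M N) (i : ℤ) : DMSym M N :=
  match y i with
  | .la k => .la k
  | .u k => .u k
  | .r => .ra (labf y i)

lemma forget_psi0 (y : ℤ → BSym M N) (i : ℤ) : BSym.forget (psi0 y i) = y i := by
  unfold psi0; cases y i <;> rfl

lemma Hfun_psi0 (y : ℤ → BSym M N) : Hfun (psi0 y) = HB y := by
  rw [← HB_forget]
  congr 1; funext i; exact forget_psi0 y i

lemma psi0_mem (y : ℤ → BSym M N) : psi0 y ∈ SigmaD M N := by
  apply mem_of_matched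
  intro j i a b hm hj hi
  rw [Hfun_psi0] at hm
  have h1 : y j = .la a := by rw [← forget_psi0 y j, hj]; rfl
  have h2 : y i = .r := by rw [← forget_psi0 y i, hi]; rfl
  have h3 : psi0 y i = .ra (labf y i) := by simp only [psi0, h2]
  rw [h3] at hi
  have h4 := DMSym.ra.inj hi
  rw [← h4, labf_eq ⟨j, hm, h1⟩]

/-- The lifting map to `Σ_D`. -/
noncomputable def psi (y : ℤ → BSym M N) : ↥(SigmaD M N) := ⟨psi0 y, psi0_mem y⟩

/-- The forgetful map on `Σ_D`. -/
def piD (x : ↥(SigmaD M N)) : ℤ → BSym M N := fun i => BSym.forget (x.1 i)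

lemma piD_psi (y : ℤ → BSym M N) : piD (psi y) = y := funext fun i => forget_psi0 y i

lemma piD_shift (x : ↥(SigmaD M N)) : piD (shiftD M N x) = shift (piD x) := rfl

lemma continuous_piD : Continuous (piD : ↥(SigmaD M N) → ℤ → BSym M N) := by
  refine continuous_pi fun i => ?_
  exact (continuous_of_discreteTopology (f := (BSym.forget : DMSym M N → BSym M N))).comp
    ((continuous_apply i).comp continuous_subtype_val)

lemma Lab_shift (y : ℤ → BSym M N) (i : ℤ) : Lab (shift y) i = Lab y (i + 1) := by
  have hH : ∀ k, HB (shift y) k = HB y (k + 1) - HB y 1 := fun k => HB_shift y 1 k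
  funext a
  apply propext
  constructor
  · rintro ⟨j, ⟨h1, h2, h3⟩, h4⟩
    refine ⟨j + 1, ⟨by omega, ?_, fun k hk1 hk2 => ?_⟩, h4⟩
    · rw [hH, hH] at h2; omega
    · have := h3 (k - 1) (by omega) (by omega)
      rw [hH, hH, sub_add_cancel] at this; omega
  · rintro ⟨j, ⟨h1, h2, h3⟩, h4⟩
    refine ⟨j - 1, ⟨by omega, ?_, fun k hk1 hk2 => ?_⟩, ?_⟩
    · rw [hH, hH, sub_add_cancel]; omega
    · have := h3 (k + 1) (by omega) (by omega)
      rw [hH, hH, sub_add_cancel]; omega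
    · simp only [shift, sub_add_cancel]; exact h4

lemma psi_shift (y : ℤ → BSym M N) : psi (shift y) = shiftD M N (psi y) := by
  apply Subtype.ext
  funext i
  change psi0 (shift y) i = psi0 y (i + 1)
  have : labf (shift y) i = labf y (i + 1) := by
    unfold labf; rw [Lab_shift]
  simp only [psi0, this, shift]

/-- All right brackets have a partner. -/
def AllM (y : ℤ → BSym M N) : Prop := ∀ i, y i = .r → ∃ a, Lab y i a

lemma psi_piD (x : ↥(SigmaD M N)) (h : AllM (piD x)) : psi (piD x) = x := by
  apply Subtype.ext
  funext i
  change psi0 (piD x) i = x.1 i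
  rcases hx : x.1 i with a | a | b
  · have : piD x i = .la a := by simp only [piD, hx]; rfl
    simp only [psi0, this]
  · have : piD x i = .u a := by simp only [piD, hx]; rfl
    simp only [psi0, this]
  · have h1 : piD x i = .r := by simp only [piD, hx]; rfl
    simp only [psi0, h1]
    obtain ⟨a, ha⟩ := h i h1
    rw [labf_eq ha]
    obtain ⟨j, hm, hj⟩ := ha
    have hm' : IsMatch (Hfun x.1) j i := by
      have := HB_forget x.1
      change HB (piD x) = _ at this
      rwa [this] at hm
    obtain ⟨a', ha'⟩ := hm'.left
    have h2 := matched_of_mem x.2 j i a' b hm' ha' hx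
    simp only [piD, ha', BSym.forget] at hj
    rw [← BSym.la.inj hj, h2]

lemma allM_of_le {y : ℤ → BSym M N} (h : ∀ i, ∃ k ≤ i, HB y k ≤ HB y (i + 1)) : AllM y := by
  intro i hi
  obtain ⟨k, hk, hle⟩ := h i
  obtain ⟨j, hj⟩ := exists_match (fun i => BSym.lift (y i)) (i := i)
    (by rw [Gfun_lift, hi]; rfl) hk hle
  obtain ⟨a, ha⟩ := hj.left
  refine ⟨a, j, hj, ?_⟩
  rcases hy : y j with c | c | c
  · rw [hy] at ha; simp only [BSym.lift] at ha; rw [DMSym.la.inj ha]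
  · rw [hy] at ha; simp [BSym.lift] at ha
  · rw [hy] at ha; simp [BSym.lift] at ha

lemma continuous_HB (i : ℤ) : Continuous fun y : ℤ → BSym M N => HB y i := by
  have hG : ∀ i, Continuous fun y : ℤ → BSym M N => GB (y i) := fun i =>
    (continuous_of_discreteTopology (f := (GB : BSym M N → ℤ))).comp (continuous_apply i)
  induction i with
  | zero => simp only [HB_zero]; exact continuous_const
  | succ i ih => simp only [HB_succ]; exact ih.add (hG _)
  | pred i ih =>
    have : ∀ y : ℤ → BSym M N, HB y (-i - 1) = HB y (-i) - GB (y (-i - 1)) := by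
      intro y
      have := HB_succ y (-i - 1)
      rw [sub_add_cancel] at this; omega
    simp only [this]; exact ih.sub (hG _)

lemma isOpen_coord (i : ℤ) (b : BSym M N) : IsOpen {y : ℤ → BSym M N | y i = b} := by
  have h : Continuous fun y : ℤ → BSym M N => y i := continuous_apply i
  exact h.isOpen_preimage {b} (isOpen_discrete _)

lemma isOpen_Lab (i : ℤ) (a : Fin M) : IsOpen {y : ℤ → BSym M N | Lab y i a} := by
  have : {y : ℤ → BSym M N | Lab y i a} = ⋃ j : ℤ, ({y | j < i} ∩ {y | HB y j = HB y (i + 1)} ∩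
      (⋂ k ∈ Set.Ioc j i, {y | HB y j < HB y k}) ∩ {y | y j = .la a}) := by
    ext y
    simp only [Lab, IsMatch, Set.mem_ofPred_eq, Set.mem_iUnion, Set.mem_inter_iff, Set.mem_iInter,
      Set.mem_Ioc, and_imp, and_assoc]
  rw [this]
  refine isOpen_iUnion fun j => ((isOpen_const.inter ?_).inter ?_).inter (isOpen_coord _ _)
  · exact (isOpen_discrete {q : ℤ × ℤ | q.1 = q.2}).preimage
      ((continuous_HB j).prodMk (continuous_HB (i + 1)))
  · exact (Set.finite_Ioc j i).isOpen_biInter fun k _ =>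
      isOpen_lt (continuous_HB j) (continuous_HB k)

lemma measurable_psi : Measurable (psi : (ℤ → BSym M N) → ↥(SigmaD M N)) := by
  refine Measurable.subtype_mk (measurable_pi_lambda _ fun i => ?_)
  have hlab : Measurable fun y : ℤ → BSym M N => labf y i := by
    refine measurable_to_countable' fun a => ?_
    by_cases ha : a = 0
    · have : (fun y : ℤ → BSym M N => labf y i) ⁻¹' {a} =
          ({y | Lab y i a} ∪ (⋃ b, {y | Lab y i b})ᶜ) := by
        ext y
        simp only [Set.mem_preimage, Set.mem_singleton_iff, Set.mem_union, Set.mem_ofPred_eq,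
          Set.mem_compl_iff, Set.mem_iUnion]
        constructor
        · intro h
          by_cases hex : ∃ b, Lab y i b
          · obtain ⟨b, hb⟩ := hex
            rw [labf_eq hb] at h; subst h; exact Or.inl hb
          · exact Or.inr hex
        · rintro (h | h)
          · exact labf_eq h
          · rw [labf_eq_zero h, ha]
      rw [this]
      exact (isOpen_Lab i a).measurableSet.union
        (isOpen_iUnion fun b => isOpen_Lab i b).measurableSet.compl
    · have : (fun y : ℤ → BSym M N => labf y i) ⁻¹' {a} = {y | Lab y i a} := by
        ext y
        simp only [Set.mem_preimage, Set.mem_singleton_iff, Set.mem_ofPred_eq]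
        constructor
        · intro h
          by_cases hex : ∃ b, Lab y i b
          · obtain ⟨b, hb⟩ := hex
            rw [labf_eq hb] at h; subst h; exact hb
          · rw [labf_eq_zero hex] at h; exact absurd h.symm ha
        · exact labf_eq
      rw [this]; exact (isOpen_Lab i a).measurableSet
  have h2 : Measurable fun q : BSym M N × Fin M => (match q.1 with
      | .la k => DMSym.la k
      | .u k => DMSym.u k
      | .r => DMSym.ra q.2 : DMSym M N) := measurable_of_countable _
  exact h2.comp ((measurable_pi_apply i).prodMk hlab)

lemma continuousAt_psi {y : ℤ → BSym M N} (hy : AllM y) :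
    ContinuousAt (psi : (ℤ → BSym M N) → ↥(SigmaD M N)) y := by
  rw [Topology.IsInducing.subtypeVal.continuousAt_iff, continuousAt_pi]
  intro i
  have : ∀ᶠ y' in 𝓝 y, psi0 y' i = psi0 y i := by
    have h0 : ∀ᶠ y' in 𝓝 y, y' i = y i := (isOpen_coord i (y i)).mem_nhds rfl
    rcases hi : y i with k | k | _
    · filter_upwards [h0] with y' h; rw [hi] at h; simp only [psi0, hi, h]
    · filter_upwards [h0] with y' h; rw [hi] at h; simp only [psi0, hi, h]
    · obtain ⟨a, ha⟩ := hy i hi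
      have h1 : ∀ᶠ y' in 𝓝 y, Lab y' i a := (isOpen_Lab i a).mem_nhds ha
      filter_upwards [h0, h1] with y' h h'
      rw [hi] at h
      simp only [psi0, hi, h, labf_eq ha, labf_eq h']
  exact tendsto_const_nhds.congr' (this.mono fun _ h => h.symm)

end Lift

section Mapping

/-- Continuous mapping theorem for an almost everywhere continuous map. -/
lemma continuousAt_pm_map {X Y : Type*} [TopologicalSpace X] [MeasurableSpace X]
    [TopologicalSpace.PseudoMetrizableSpace X] [TopologicalSpace.SeparableSpace X] [BorelSpace X]
    [TopologicalSpace Y] [MeasurableSpace Y]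
    [TopologicalSpace.PseudoMetrizableSpace Y] [BorelSpace Y]
    {ψ : X → Y} (hψ : Measurable ψ) (ν : ProbabilityMeasure X)
    (hc : ∀ᵐ y ∂(ν : Measure X), ContinuousAt ψ y) :
    ContinuousAt (fun ρ : ProbabilityMeasure X => ρ.map hψ.aemeasurable) ν := by
  refine tendsto_of_forall_isOpen_le_liminf' fun G hG => ?_
  have h1 : (ν : Measure X) (ψ ⁻¹' G) ≤ (ν : Measure X) (interior (ψ ⁻¹' G)) := by
    refine measure_mono_ae ?_
    filter_upwards [hc] with y hy hyG
    exact mem_interior_iff_mem_nhds.2 (hy.preimage_mem_nhds (hG.mem_nhds hyG))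
  have h2 := ProbabilityMeasure.le_liminf_measure_open_of_tendsto (L := 𝓝 ν)
    (μs := fun ρ : ProbabilityMeasure X => ρ) (μ := ν) tendsto_id
    (isOpen_interior (s := ψ ⁻¹' G))
  have h3 : ∀ ρ : ProbabilityMeasure X,
      ((ρ.map hψ.aemeasurable : ProbabilityMeasure Y) : Measure Y) G = (ρ : Measure X) (ψ ⁻¹' G) :=
    fun ρ => by
      rw [ProbabilityMeasure.toMeasure_map, Measure.map_apply hψ hG.measurableSet]
  simp only [h3]
  refine h1.trans (h2.trans ?_)
  exact liminf_le_liminf (Eventually.of_forall fun ρ => measure_mono interior_subset)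

end Mapping

section Drift

lemma shift_iterate {A : Type*} (n : ℕ) (y : ℤ → A) : shift^[n] y = fun k => y (k + n) := by
  induction n with
  | zero => simp
  | succ n ih =>
    rw [Function.iterate_succ_apply', ih]; funext k
    simp only [shift]; exact congrArg _ (by push_cast; ring)

lemma shiftInv_iterate {A : Type*} (n : ℕ) (y : ℤ → A) : shiftInv^[n] y = fun k => y (k - n) := by
  induction n with
  | zero => simp
  | succ n ih =>
    rw [Function.iterate_succ_apply', ih]; funext k
    simp only [shiftInv]; exact congrArg _ (by push_cast; ring)

/-- The shift as a measurable equivalence. -/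
def shiftE (A : Type*) [MeasurableSpace A] : (ℤ → A) ≃ᵐ (ℤ → A) where
  toFun := shift
  invFun := shiftInv
  left_inv := shiftInv_shift
  right_inv := shift_shiftInv
  measurable_toFun := measurable_shift
  measurable_invFun := measurable_shiftInv

lemma ergodic_shiftInv {A : Type*} [MeasurableSpace A] {μ : Measure (ℤ → A)}
    (h : Ergodic shift μ) : Ergodic shiftInv μ :=
  Ergodic.symm (e := shiftE A) h

lemma sft_mp {A : Type*} [MeasurableSpace A] {μ : Measure (ℤ → A)}
    (h : MeasurePreserving shift μ μ) (i : ℤ) :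
    MeasurePreserving (fun (y : ℤ → A) k => y (k + i)) μ μ := by
  rcases Int.eq_nat_or_neg i with ⟨n, rfl | rfl⟩
  · convert h.iterate n using 1
    funext y; rw [shift_iterate]
  · convert (shiftInv_mp h).iterate n using 1
    funext y; rw [shiftInv_iterate]; rfl

variable {M N : ℕ} [NeZero M]

/-- The drift potential. -/
def gB (M N : ℕ) (b : BSym M N) : ℝ := (GB b : ℝ)

lemma birk_fwd (n : ℕ) (y : ℤ → BSym M N) :
    birkhoffSum shift (fun y : ℤ → BSym M N => GB (y 0)) n y = HB y n := by
  induction n with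
  | zero => simp [HB_zero]
  | succ n ih =>
    rw [birkhoffSum_succ, ih, shift_iterate]; push_cast; rw [HB_succ]; simp

lemma birk_bwd (n : ℕ) (y : ℤ → BSym M N) :
    birkhoffSum shiftInv (fun y : ℤ → BSym M N => GB (y (-1))) n y = -HB y (-n) := by
  induction n with
  | zero => simp [HB_zero]
  | succ n ih =>
    rw [birkhoffSum_succ, ih, shiftInv_iterate]
    have := HB_succ y (-(n : ℤ) - 1)
    rw [sub_add_cancel] at this
    rw [this]; push_cast
    rw [show -1 - (n : ℤ) = -(n : ℤ) - 1 by ring, show -((n : ℤ) + 1) = -(n : ℤ) - 1 by ring]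
    ring

lemma birk_cast {X : Type*} (T : X → X) (g : X → ℤ) (n : ℕ) (x : X) :
    birkhoffSum T (fun x => (g x : ℝ)) n x = ((birkhoffSum T g n x : ℤ) : ℝ) := by
  simp [birkhoffSum]

lemma measurable_GB (i : ℤ) : Measurable fun y : ℤ → BSym M N => GB (y i) :=
  (measurable_of_countable (GB : BSym M N → ℤ)).comp (measurable_pi_apply i)

lemma measurable_gB (i : ℤ) : Measurable fun y : ℤ → BSym M N => (GB (y i) : ℝ) :=
  (measurable_of_countable (gB M N)).comp (measurable_pi_apply i)

lemma GB_bdd (b : BSym M N) : |(GB b : ℝ)| ≤ 1 := by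
  cases b <;> simp [GB]

lemma int_bwd {ν : Measure (ℤ → BSym M N)} (h : MeasurePreserving shift ν ν) :
    ∫ y, (GB (y (-1)) : ℝ) ∂ν = ∫ y, (GB (y 0) : ℝ) ∂ν := by
  have hm := sft_mp h (-1)
  have := integral_map (μ := ν) hm.measurable.aemeasurable
    (f := fun y : ℤ → BSym M N => (GB (y 0) : ℝ)) (measurable_gB 0).aestronglyMeasurable
  rw [hm.map_eq] at this
  rw [this]; simp

/-- Recurrence of heights. -/
def RecH (h : ℤ → ℤ) : Prop := ∀ i : ℤ,
    (∃ j : ℕ, 1 ≤ j ∧ h (i + (j : ℤ)) = h i) ∧ (∃ j : ℕ, 1 ≤ j ∧ h (i - (j : ℤ)) = h i)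

/-- Transience of heights. -/
def TransH (h : ℤ → ℤ) : Prop := Tendsto h atTop atTop ∧ Tendsto h atBot atBot

lemma ae_RecH {ν : Measure (ℤ → BSym M N)} [IsProbabilityMeasure ν] (h : Ergodic shift ν)
    (h0 : ∫ y, (GB (y 0) : ℝ) ∂ν = 0) : ∀ᵐ y ∂ν, RecH (HB y) := by
  have hf := birkhoffSum_recurrent h (measurable_GB (M := M) (N := N) 0) (C := 1)
    (fun y => GB_bdd _) h0
  have hb := birkhoffSum_recurrent (ergodic_shiftInv h) (measurable_GB (M := M) (N := N) (-1))
    (C := 1) (fun y => GB_bdd _) ((int_bwd h.toMeasurePreserving).trans h0)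
  simp only [birk_fwd] at hf
  simp only [birk_bwd] at hb
  have h1 : ∀ᵐ y ∂ν, ∀ i : ℤ, ∃ n : ℕ, 1 ≤ n ∧ HB (fun k => y (k + i)) n = 0 :=
    ae_all_iff.2 fun i => (sft_mp h.toMeasurePreserving i).quasiMeasurePreserving.ae hf
  have h2 : ∀ᵐ y ∂ν, ∀ i : ℤ, ∃ n : ℕ, 1 ≤ n ∧ -HB (fun k => y (k + i)) (-n) = 0 :=
    ae_all_iff.2 fun i => (sft_mp h.toMeasurePreserving i).quasiMeasurePreserving.ae hb
  filter_upwards [h1, h2] with y h1 h2 i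
  constructor
  · obtain ⟨n, hn, he⟩ := h1 i
    rw [HB_shift] at he
    exact ⟨n, hn, by rw [add_comm i]; omega⟩
  · obtain ⟨n, hn, he⟩ := h2 i
    rw [HB_shift] at he
    exact ⟨n, hn, by rw [show i - (n : ℤ) = -n + i by ring]; omega⟩

lemma int_tendsto_atTop {h : ℤ → ℤ} (H : Tendsto (fun n : ℕ => h n) atTop atTop) :
    Tendsto h atTop atTop := by
  have : Tendsto h (map ((↑) : ℕ → ℤ) atTop) atTop := tendsto_map'_iff.2 H
  rwa [Nat.map_cast_int_atTop] at this

lemma ae_TransH {ν : Measure (ℤ → BSym M N)} [IsProbabilityMeasure ν] (h : Ergodic shift ν)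
    (h0 : 0 < ∫ y, (GB (y 0) : ℝ) ∂ν) : ∀ᵐ y ∂ν, TransH (HB y) := by
  have hf := birkhoffSum_tendsto_of_pos h (measurable_gB (M := M) (N := N) 0) (C := 1)
    (fun y => GB_bdd _) h0
  have hb := birkhoffSum_tendsto_of_pos (ergodic_shiftInv h)
    (measurable_gB (M := M) (N := N) (-1))
    (C := 1) (fun y => GB_bdd _) (h0.trans_eq (int_bwd h.toMeasurePreserving).symm)
  simp only [birk_cast, birk_fwd] at hf
  simp only [birk_cast, birk_bwd] at hb
  filter_upwards [hf, hb] with y h1 h2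
  constructor
  · exact int_tendsto_atTop (tendsto_intCast_atTop_iff.1 h1)
  · have h3 := int_tendsto_atTop (h := fun i => -HB y (-i)) (tendsto_intCast_atTop_iff.1 h2)
    have h4 := tendsto_neg_atTop_atBot.comp (h3.comp tendsto_neg_atBot_atTop)
    refine h4.congr fun i => ?_
    simp

lemma ae_neg {ν : Measure (ℤ → BSym M N)} [IsProbabilityMeasure ν] (h : Ergodic shift ν)
    (h0 : ∫ y, (GB (y 0) : ℝ) ∂ν < 0) : ∀ᵐ y ∂ν, ¬ RecH (HB y) ∧ ¬ TransH (HB y) := by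
  have hf := birkhoffSum_tendsto_of_pos h (g := fun y : ℤ → BSym M N => ((-GB (y 0) : ℤ) : ℝ))
    (by simp only [Int.cast_neg]; exact (measurable_gB (M := M) (N := N) 0).neg) (C := 1)
    (fun y => by push_cast; rw [abs_neg]; exact GB_bdd _)
    (by push_cast; rw [integral_neg]; linarith)
  have hn : ∀ (n : ℕ) (y : ℤ → BSym M N),
      birkhoffSum shift (fun y : ℤ → BSym M N => -GB (y 0)) n y = -HB y n := by
    intro n y
    rw [← birk_fwd]; simp [birkhoffSum]
  simp only [birk_cast, hn] at hf
  filter_upwards [hf] with y h1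
  have h2 := tendsto_intCast_atTop_iff.1 h1
  obtain ⟨n0, hn0⟩ := eventually_atTop.1 (h2.eventually (eventually_ge_atTop 1))
  constructor
  · intro hr
    have : ∀ m : ℕ, ∃ n : ℕ, m ≤ n ∧ HB y n = 0 := by
      intro m
      induction m with
      | zero => exact ⟨0, le_rfl, by simpa using HB_zero y⟩
      | succ m ih =>
        obtain ⟨n, hn, he⟩ := ih
        obtain ⟨j, hj, hje⟩ := (hr n).1
        exact ⟨n + j, by omega, by push_cast; rw [hje, he]⟩
    obtain ⟨n, hn, he⟩ := this n0
    have := hn0 n hn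
    omega
  · intro ht
    have h3 : Tendsto (fun n : ℕ => HB y n) atTop atTop := ht.1.comp tendsto_natCast_atTop_atTop
    obtain ⟨n, hn1, hn2⟩ := ((h3.eventually (eventually_ge_atTop 1)).and
      (eventually_ge_atTop n0)).exists
    have := hn0 n hn2
    omega

lemma allM_RecH {y : ℤ → BSym M N} (h : RecH (HB y)) : AllM y := by
  refine allM_of_le fun i => ?_
  obtain ⟨j, hj, he⟩ := (h (i + 1)).2
  exact ⟨i + 1 - j, by omega, he.le⟩

lemma allM_TransH {y : ℤ → BSym M N} (h : TransH (HB y)) : AllM y := by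
  refine allM_of_le fun i => ?_
  obtain ⟨k, hk1, hk2⟩ := ((h.2.eventually (eventually_le_atBot (HB y (i + 1)))).and
    (eventually_le_atBot i)).exists
  exact ⟨k, hk2, hk1⟩

lemma measurable_Hfun (i : ℤ) : Measurable fun x : ↥(SigmaD M N) => Hfun x.1 i := by
  have : (fun x : ↥(SigmaD M N) => Hfun x.1 i) = fun x => HB (piD x) i := by
    funext x; rw [← HB_forget x.1]; rfl
  rw [this]
  exact (continuous_HB i).measurable.comp continuous_piD.measurable

lemma measurableSet_A0 : MeasurableSet (Subtype.val ⁻¹' A0set M N : Set ↥(SigmaD M N)) := by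
  have : (Subtype.val ⁻¹' A0set M N : Set ↥(SigmaD M N)) = ⋂ i : ℤ,
      ((⋃ j : ℕ, ⋃ (_ : 1 ≤ j), {x | Hfun x.1 (i + (j : ℤ)) = Hfun x.1 i}) ∩
      (⋃ j : ℕ, ⋃ (_ : 1 ≤ j), {x | Hfun x.1 (i - (j : ℤ)) = Hfun x.1 i})) := by
    ext x; simp [A0set]
  rw [this]
  refine MeasurableSet.iInter fun i => MeasurableSet.inter ?_ ?_ <;>
  exact MeasurableSet.iUnion fun j => MeasurableSet.iUnion fun _ =>
    measurableSet_eq_fun (measurable_Hfun _) (measurable_Hfun _)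

lemma measurableSet_Aal : MeasurableSet (Subtype.val ⁻¹' AalphaSet M N : Set ↥(SigmaD M N)) := by
  have : (Subtype.val ⁻¹' AalphaSet M N : Set ↥(SigmaD M N)) =
      {x | Tendsto (fun n => Hfun x.1 n) atTop atTop} ∩
      {x | Tendsto (fun n => Hfun x.1 n) atBot atBot} := by
    ext x; simp [AalphaSet]
  rw [this]
  exact (measurableSet_tendsto _ measurable_Hfun).inter (measurableSet_tendsto _ measurable_Hfun)

lemma mem_A0_iff (x : ↥(SigmaD M N)) : x ∈ (Subtype.val ⁻¹' A0set M N : Set ↥(SigmaD M N)) ↔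
    RecH (HB (piD x)) := by
  have : HB (piD x) = Hfun x.1 := HB_forget x.1
  rw [this]
  exact ⟨fun h => h.2, fun h => ⟨x.2, h⟩⟩

lemma mem_Aal_iff (x : ↥(SigmaD M N)) :
    x ∈ (Subtype.val ⁻¹' AalphaSet M N : Set ↥(SigmaD M N)) ↔ TransH (HB (piD x)) := by
  have : HB (piD x) = Hfun x.1 := HB_forget x.1
  rw [this]
  exact ⟨fun h => h.2, fun h => ⟨x.2, h⟩⟩

lemma me0_iff (μ : ProbabilityMeasure ↥(SigmaD M N)) : μ ∈ Me0 M N ↔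
    Ergodic (shiftD M N) (μ : Measure ↥(SigmaD M N)) ∧
      ∀ᵐ x ∂(μ : Measure ↥(SigmaD M N)), RecH (HB (piD x)) := by
  refine and_congr Iff.rfl ?_
  rw [← mem_ae_iff_prob_eq_one measurableSet_A0]
  exact eventually_congr (Eventually.of_forall mem_A0_iff)

lemma meAl_iff (μ : ProbabilityMeasure ↥(SigmaD M N)) : μ ∈ MeAl M N ↔
    Ergodic (shiftD M N) (μ : Measure ↥(SigmaD M N)) ∧
      ∀ᵐ x ∂(μ : Measure ↥(SigmaD M N)), TransH (HB (piD x)) := by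
  refine and_congr Iff.rfl ?_
  rw [← mem_ae_iff_prob_eq_one measurableSet_Aal]
  exact eventually_congr (Eventually.of_forall mem_Aal_iff)

lemma measurable_shiftD : Measurable (shiftD M N) :=
  (measurable_shift.comp measurable_subtype_coe).subtype_mk

lemma ae_dich {ν : ProbabilityMeasure (ℤ → BSym M N)} (h : ν ∈ Eset (gB M N)) :
    (∀ᵐ y ∂(ν : Measure (ℤ → BSym M N)), RecH (HB y)) ∨
    (∀ᵐ y ∂(ν : Measure (ℤ → BSym M N)), TransH (HB y)) := by
  rcases eq_or_lt_of_le h.2 with h0 | h0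
  · exact Or.inl (ae_RecH h.1 h0.symm)
  · exact Or.inr (ae_TransH h.1 h0)

lemma ae_allM {ν : ProbabilityMeasure (ℤ → BSym M N)} (h : ν ∈ Eset (gB M N)) :
    ∀ᵐ y ∂(ν : Measure (ℤ → BSym M N)), AllM y := by
  rcases ae_dich h with h | h
  · exact h.mono fun y => allM_RecH
  · exact h.mono fun y => allM_TransH

lemma map_psi_mem {ν : ProbabilityMeasure (ℤ → BSym M N)} (h : ν ∈ Eset (gB M N)) :
    ν.map (measurable_psi (M := M) (N := N)).aemeasurable ∈ Me0 M N ∪ MeAl M N := by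
  have hmp : MeasurePreserving (psi (M := M) (N := N)) (ν : Measure (ℤ → BSym M N))
      (ν.map (measurable_psi (M := M) (N := N)).aemeasurable : ProbabilityMeasure _) :=
    ⟨measurable_psi, rfl⟩
  have he : Ergodic (shiftD M N)
      ((ν.map (measurable_psi (M := M) (N := N)).aemeasurable : ProbabilityMeasure _) :
        Measure ↥(SigmaD M N)) :=
    hmp.ergodic_of_ergodic_semiconj h.1 measurable_shiftD fun y => psi_shift y
  rcases ae_dich h with h1 | h1
  · left
    refine (me0_iff _).2 ⟨he, ?_⟩
    rw [ProbabilityMeasure.toMeasure_map, ae_map_iff measurable_psi.aemeasurable]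
    · simpa only [piD_psi] using h1
    · convert measurableSet_A0 (M := M) (N := N) using 1
      ext x; exact (mem_A0_iff x).symm
  · right
    refine (meAl_iff _).2 ⟨he, ?_⟩
    rw [ProbabilityMeasure.toMeasure_map, ae_map_iff measurable_psi.aemeasurable]
    · simpa only [piD_psi] using h1
    · convert measurableSet_Aal (M := M) (N := N) using 1
      ext x; exact (mem_Aal_iff x).symm

lemma measurable_piD : Measurable (piD : ↥(SigmaD M N) → ℤ → BSym M N) :=
  continuous_piD.measurable

lemma map_piD_mem {μ : ProbabilityMeasure ↥(SigmaD M N)} (h : μ ∈ Me0 M N ∪ MeAl M N) :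
    μ.map (measurable_piD (M := M) (N := N)).aemeasurable ∈ Eset (gB M N) := by
  have herg : Ergodic (shiftD M N) (μ : Measure ↥(SigmaD M N)) := by
    rcases h with h | h <;> exact h.1
  have hmp : MeasurePreserving (piD (M := M) (N := N)) (μ : Measure ↥(SigmaD M N))
      (μ.map (measurable_piD (M := M) (N := N)).aemeasurable : ProbabilityMeasure _) :=
    ⟨measurable_piD, rfl⟩
  have he := hmp.ergodic_of_ergodic_semiconj herg measurable_shift fun x => piD_shift x
  refine ⟨he, ?_⟩
  by_contra hneg
  have h1 := hmp.quasiMeasurePreserving.ae (ae_neg he (not_le.1 hneg))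
  rcases h with h | h
  · obtain ⟨x, hx1, hx2⟩ := (h1.and ((me0_iff μ).1 h).2).exists
    exact hx1.1 hx2
  · obtain ⟨x, hx1, hx2⟩ := (h1.and ((meAl_iff μ).1 h).2).exists
    exact hx1.2 hx2

lemma ae_psi_piD {μ : ProbabilityMeasure ↥(SigmaD M N)} (h : μ ∈ Me0 M N ∪ MeAl M N) :
    ∀ᵐ x ∂(μ : Measure ↥(SigmaD M N)), psi (piD x) = x := by
  rcases h with h | h
  · exact ((me0_iff μ).1 h).2.mono fun x hx => psi_piD x (allM_RecH hx)
  · exact ((meAl_iff μ).1 h).2.mono fun x hx => psi_piD x (allM_TransH hx)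

/-- The homeomorphism between the spaces of measures. -/
noncomputable def homeoEA (M N : ℕ) [NeZero M] :
    ↥(Eset (gB M N)) ≃ₜ ↥(Me0 M N ∪ MeAl M N) where
  toFun ν := ⟨ν.1.map (measurable_psi (M := M) (N := N)).aemeasurable, map_psi_mem ν.2⟩
  invFun μ := ⟨μ.1.map (measurable_piD (M := M) (N := N)).aemeasurable, map_piD_mem μ.2⟩
  left_inv ν := by
    apply Subtype.ext; apply Subtype.ext
    change Measure.map piD (Measure.map psi (ν.1 : Measure (ℤ → BSym M N))) = _
    rw [Measure.map_map measurable_piD measurable_psi]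
    have : piD ∘ psi = (id : (ℤ → BSym M N) → _) := funext piD_psi
    rw [this, Measure.map_id]; rfl
  right_inv μ := by
    apply Subtype.ext; apply Subtype.ext
    change Measure.map psi (Measure.map piD (μ.1 : Measure ↥(SigmaD M N))) = _
    rw [Measure.map_map measurable_psi measurable_piD]
    exact (Measure.map_congr (g := id) (show psi ∘ piD =ᵐ[(μ.1 : Measure ↥(SigmaD M N))] id from
      ae_psi_piD μ.2)).trans Measure.map_id
  continuous_toFun := by
    refine Continuous.subtype_mk ?_ _
    rw [continuous_iff_continuousAt]
    intro ν
    exact (continuousAt_pm_map measurable_psi ν.1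
      ((ae_allM ν.2).mono fun y hy => continuousAt_psi hy)).comp continuousAt_subtype_val
  continuous_invFun := by
    refine Continuous.subtype_mk ?_ _
    exact (ProbabilityMeasure.continuous_map continuous_piD).comp continuous_subtype_val

lemma Eset_nonempty : (Eset (gB M N)).Nonempty := by
  set y0 : ℤ → BSym M N := fun _ => .la 0
  have hfix : shift y0 = y0 := rfl
  refine ⟨⟨Measure.dirac y0, inferInstance⟩, ?_, ?_⟩
  · change Ergodic shift (Measure.dirac y0)
    refine ⟨⟨measurable_shift, ?_⟩, ⟨fun s hs _ => ?_⟩⟩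
    · rw [Measure.map_dirac' measurable_shift, hfix]
    · rw [Filter.eventuallyConst_set']
      by_cases h : y0 ∈ s
      · right
        have : ∀ᵐ y ∂(Measure.dirac y0), y ∈ s := (ae_dirac_iff hs).2 h
        exact eventuallyEq_univ.2 this
      · left
        have : ∀ᵐ y ∂(Measure.dirac y0), y ∉ s := (ae_dirac_iff hs.compl).2 h
        exact eventuallyEq_empty.2 this
  · change 0 ≤ ∫ y, gB M N (y 0) ∂(Measure.dirac y0)
    rw [integral_dirac]
    simp [gB, GB, y0]

lemma locPC_homeo {X Y : Type*} [TopologicalSpace X] [TopologicalSpace Y] (e : X ≃ₜ Y)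
    (h : LocallyPathConnectedSpace X) : LocallyPathConnectedSpace Y :=
  e.symm.isOpenEmbedding.locallyPathConnectedSpace

lemma pc_homeo {X Y : Type*} [TopologicalSpace X] [TopologicalSpace Y] (e : X ≃ₜ Y)
    (h : PathConnectedSpace X) : PathConnectedSpace Y :=
  e.surjective.pathConnectedSpace e.continuous

theorem main_alpha (M N : ℕ) [NeZero M] : PathConnectedSpace ↥(Me0 M N ∪ MeAl M N) ∧
    LocallyPathConnectedSpace ↥(Me0 M N ∪ MeAl M N) :=
  ⟨pc_homeo (homeoEA M N) (Eset_pathConnected Eset_nonempty),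
    locPC_homeo (homeoEA M N) Eset_locPathConnected⟩

end Drift

section Reversal

variable {M N : ℕ}

/-- Exchange of left and right brackets. -/
def bar : DMSym M N → DMSym M N
  | .la a => .ra a
  | .u a => .u a
  | .ra a => .la a

lemma bar_bar (s : DMSym M N) : bar (bar s) = s := by cases s <;> rfl

/-- Time reversal. -/
def rev (x : ℤ → DMSym M N) : ℤ → DMSym M N := fun i => bar (x (-i))

lemma rev_rev (x : ℤ → DMSym M N) : rev (rev x) = x := by
  funext i; simp [rev, bar_bar]

lemma Gfun_rev (x : ℤ → DMSym M N) (i : ℤ) : Gfun (rev x) i = -Gfun x (-i) := by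
  simp only [Gfun, rev]
  cases x (-i) <;> rfl

lemma Hfun_rev (x : ℤ → DMSym M N) (i : ℤ) : Hfun (rev x) i = Hfun x (1 - i) - Hfun x 1 := by
  have := height_unique (h := Hfun (rev x)) (h' := fun i => Hfun x (1 - i))
    (fun i => by
      beta_reduce
      rw [Hfun_succ, Gfun_rev, show 1 - (i + 1) = -i by ring, show 1 - i = -i + 1 by ring,
        Hfun_succ]
      ring) i
  simp only [Hfun_zero, sub_zero] at this
  linarith

lemma rev_mem {x : ℤ → DMSym M N} (hx : x ∈ SigmaD M N) : rev x ∈ SigmaD M N := by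
  have hm := matched_of_mem hx
  refine mem_of_matched fun j i a b hji hj hi => ?_
  have h1 : x (-j) = .ra a := by
    have := congrArg bar hj; simp only [rev, bar_bar] at this; exact this
  have h2 : x (-i) = .la b := by
    have := congrArg bar hi; simp only [rev, bar_bar] at this; exact this
  refine (hm (-i) (-j) b a ⟨by have := hji.1; omega, ?_, fun k hk1 hk2 => ?_⟩ h2 h1).symm
  · have := hji.2.1
    rw [Hfun_rev, Hfun_rev] at this
    rw [show -j + 1 = 1 - j by ring]
    rw [show 1 - (i + 1) = -i by ring] at this
    omega
  · have h3 := hji.2.2 (1 - k) (by omega) (by omega)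
    have h4 := hji.2.1
    rw [Hfun_rev, Hfun_rev] at h3 h4
    rw [show 1 - (i + 1) = -i by ring] at h4
    rw [show 1 - (1 - k) = k by ring] at h3
    omega

lemma shiftInv_mem {x : ℤ → DMSym M N} (hx : x ∈ SigmaD M N) : shiftInv x ∈ SigmaD M N := by
  have : shiftInv x = rev (shift (rev x)) := by
    funext i
    simp only [shiftInv, rev, shift, bar_bar]
    exact congrArg _ (by ring)
  rw [this]
  exact rev_mem (shift_mem_SigmaD (rev_mem hx))

/-- The shift on the Dyck-Motzkin shift as a measurable equivalence. -/
def shiftDE (M N : ℕ) : ↥(SigmaD M N) ≃ᵐ ↥(SigmaD M N) where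
  toFun := shiftD M N
  invFun x := ⟨shiftInv x.1, shiftInv_mem x.2⟩
  left_inv x := Subtype.ext (shiftInv_shift x.1)
  right_inv x := Subtype.ext (shift_shiftInv x.1)
  measurable_toFun := (measurable_shift.comp measurable_subtype_coe).subtype_mk
  measurable_invFun := (measurable_shiftInv.comp measurable_subtype_coe).subtype_mk

/-- Time reversal on the Dyck-Motzkin shift. -/
def revD (M N : ℕ) (x : ↥(SigmaD M N)) : ↥(SigmaD M N) := ⟨rev x.1, rev_mem x.2⟩

lemma revD_revD (x : ↥(SigmaD M N)) : revD M N (revD M N x) = x := Subtype.ext (rev_rev x.1)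

lemma continuous_revD : Continuous (revD M N) := by
  refine Continuous.subtype_mk (continuous_pi fun i => ?_) _
  exact (continuous_of_discreteTopology (f := bar)).comp
    ((continuous_apply (-i)).comp continuous_subtype_val)

/-- Time reversal as a measurable equivalence. -/
def revE (M N : ℕ) : ↥(SigmaD M N) ≃ᵐ ↥(SigmaD M N) where
  toFun := revD M N
  invFun := revD M N
  left_inv := revD_revD
  right_inv := revD_revD
  measurable_toFun := continuous_revD.measurable
  measurable_invFun := continuous_revD.measurable

lemma revD_semiconj (x : ↥(SigmaD M N)) :
    revD M N ((shiftDE M N).symm x) = shiftD M N (revD M N x) := by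
  apply Subtype.ext
  funext i
  change bar (x.1 (-i - 1)) = bar (x.1 (-(i + 1)))
  rw [show -i - 1 = -(i + 1) by ring]

/-- Push-forward under time reversal. -/
noncomputable def revM (μ : ProbabilityMeasure ↥(SigmaD M N)) : ProbabilityMeasure ↥(SigmaD M N) :=
  μ.map (continuous_revD (M := M) (N := N)).measurable.aemeasurable

lemma revM_apply (μ : ProbabilityMeasure ↥(SigmaD M N)) (s : Set ↥(SigmaD M N)) :
    (revM μ : Measure ↥(SigmaD M N)) s = (μ : Measure ↥(SigmaD M N)) (revD M N ⁻¹' s) :=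
  (revE M N).map_apply s

lemma revM_revM (μ : ProbabilityMeasure ↥(SigmaD M N)) : revM (revM μ) = μ := by
  apply Subtype.ext
  refine Measure.ext fun s _ => ?_
  refine (revM_apply (revM μ) s).trans ((revM_apply μ _).trans ?_)
  congr 1
  ext x
  simp only [Set.mem_preimage, revD_revD]

lemma continuous_revM : Continuous (revM (M := M) (N := N)) :=
  ProbabilityMeasure.continuous_map continuous_revD

lemma revM_erg {μ : ProbabilityMeasure ↥(SigmaD M N)} (h : μ ∈ MergD M N) : revM μ ∈ MergD M N := by
  have h1 : Ergodic (shiftDE M N) (μ : Measure ↥(SigmaD M N)) := h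
  have h2 : Ergodic (shiftDE M N).symm (μ : Measure ↥(SigmaD M N)) := h1.symm
  have hmp : MeasurePreserving (revD M N) (μ : Measure ↥(SigmaD M N))
      (revM μ : Measure ↥(SigmaD M N)) := ⟨continuous_revD.measurable, rfl⟩
  exact hmp.ergodic_of_ergodic_semiconj h2 (shiftDE M N).measurable fun x => revD_semiconj x

lemma rev_A0 {x : ℤ → DMSym M N} (h : x ∈ A0set M N) : rev x ∈ A0set M N := by
  refine ⟨rev_mem h.1, fun i => ?_⟩
  obtain ⟨⟨j, hj, hje⟩, ⟨k, hk, hke⟩⟩ := h.2 (1 - i)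
  refine ⟨⟨k, hk, ?_⟩, ⟨j, hj, ?_⟩⟩
  · rw [Hfun_rev, Hfun_rev, ← hke, show 1 - (i + (k : ℤ)) = 1 - i - k by ring]
  · rw [Hfun_rev, Hfun_rev, ← hje, show 1 - (i - (j : ℤ)) = 1 - i + j by ring]

lemma tendsto_one_sub_top : Tendsto (fun i : ℤ => 1 - i) atTop atBot :=
  tendsto_atBot.2 fun b => (eventually_ge_atTop (1 - b)).mono fun i hi => by omega

lemma tendsto_one_sub_bot : Tendsto (fun i : ℤ => 1 - i) atBot atTop :=
  tendsto_atTop.2 fun b => (eventually_le_atBot (1 - b)).mono fun i hi => by omega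

lemma Hfun_rev_eq (x : ℤ → DMSym M N) :
    Hfun (rev x) = fun i => -Hfun x 1 + (Hfun x ∘ fun i => 1 - i) i := by
  funext i; rw [Hfun_rev]; simp only [Function.comp]; ring

lemma rev_Aal {x : ℤ → DMSym M N} (h : x ∈ AalphaSet M N) : rev x ∈ AbetaSet M N := by
  refine ⟨rev_mem h.1, ?_, ?_⟩
  · rw [Hfun_rev_eq]
    exact tendsto_atBot_add_const_left _ _ (h.2.2.comp tendsto_one_sub_top)
  · rw [Hfun_rev_eq]
    exact tendsto_atTop_add_const_left _ _ (h.2.1.comp tendsto_one_sub_bot)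

lemma rev_Abe {x : ℤ → DMSym M N} (h : x ∈ AbetaSet M N) : rev x ∈ AalphaSet M N := by
  refine ⟨rev_mem h.1, ?_, ?_⟩
  · rw [Hfun_rev_eq]
    exact tendsto_atTop_add_const_left _ _ (h.2.2.comp tendsto_one_sub_top)
  · rw [Hfun_rev_eq]
    exact tendsto_atBot_add_const_left _ _ (h.2.1.comp tendsto_one_sub_bot)

lemma revM_one {μ : ProbabilityMeasure ↥(SigmaD M N)} {s t : Set (ℤ → DMSym M N)}
    (hst : ∀ x ∈ s, rev x ∈ t)
    (h : μ.toMeasure (Subtype.val ⁻¹' s) = 1) :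
    (revM μ).toMeasure (Subtype.val ⁻¹' t) = 1 := by
  refine le_antisymm prob_le_one ?_
  rw [← h]
  refine (measure_mono ?_).trans_eq (revM_apply μ _).symm
  exact fun x hx => hst _ hx

lemma revM_al {μ : ProbabilityMeasure ↥(SigmaD M N)} (h : μ ∈ Me0 M N ∪ MeAl M N) :
    revM μ ∈ Me0 M N ∪ MeBe M N := by
  rcases h with h | h
  · exact Or.inl ⟨revM_erg h.1, revM_one (fun x => rev_A0) h.2⟩
  · exact Or.inr ⟨revM_erg h.1, revM_one (fun x => rev_Aal) h.2⟩

lemma revM_be {μ : ProbabilityMeasure ↥(SigmaD M N)} (h : μ ∈ Me0 M N ∪ MeBe M N) :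
    revM μ ∈ Me0 M N ∪ MeAl M N := by
  rcases h with h | h
  · exact Or.inl ⟨revM_erg h.1, revM_one (fun x => rev_A0) h.2⟩
  · exact Or.inr ⟨revM_erg h.1, revM_one (fun x => rev_Abe) h.2⟩

/-- Time reversal exchanges the two spaces of measures. -/
noncomputable def homeoAB (M N : ℕ) : ↥(Me0 M N ∪ MeAl M N) ≃ₜ ↥(Me0 M N ∪ MeBe M N) where
  toFun μ := ⟨revM μ.1, revM_al μ.2⟩
  invFun μ := ⟨revM μ.1, revM_be μ.2⟩
  left_inv μ := Subtype.ext (revM_revM μ.1)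
  right_inv μ := Subtype.ext (revM_revM μ.1)
  continuous_toFun := (continuous_revM.comp continuous_subtype_val).subtype_mk _
  continuous_invFun := (continuous_revM.comp continuous_subtype_val).subtype_mk _

end Reversal

/-- Proposition 3.2: the spaces `M^e_0(Σ_D) ∪ M^e_α(Σ_D)` and `M^e_0(Σ_D) ∪ M^e_β(Σ_D)`
are path connected and locally path connected. -/
theorem union_Me0_pathConnected (M N : ℕ) (hM : 2 ≤ M) :
    PathConnectedSpace ↥(Me0 M N ∪ MeAl M N) ∧
    LocPathConnectedSpace ↥(Me0 M N ∪ MeAl M N) ∧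
    PathConnectedSpace ↥(Me0 M N ∪ MeBe M N) ∧
    LocPathConnectedSpace ↥(Me0 M N ∪ MeBe M N) := by
  haveI : NeZero M := ⟨by omega⟩
  obtain ⟨h1, h2⟩ := main_alpha M N
  exact ⟨h1, h2, pc_homeo (homeoAB M N) h1, locPC_homeo (homeoAB M N) h2⟩
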